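/- arXiv:0706.1704 — 3 statements merged into one kernel-verified Lean document; each statement's English description precedes it below -/
import Mathlib

section
/- If (F, D) is a finite duality in Rel(Δ), i.e. F and D are finite sets of finite structures of type Δ with Forb(F) = CSP(D), then there exists a finite set F₀ of relational forests of type Δ with Forb(F₀) = Forb(F); in particular, up to homomorphism equivalence every finite duality has a set of forests on its left-hand side. -/
/-- A finite relational structure of signature `σ`, where symbol `s : σ` has arity `ar s`.
`rel s` is the set of `ar s`-tuples (written as functions `Fin (ar s) → carrier`)
that are in the relation `s`. -/
structure RStruct (σ : Type) (ar : σ → ℕ) : Type 1 where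
  carrier : Type
  fin : Finite carrier
  rel : ∀ s : σ, Set (Fin (ar s) → carrier)

namespace RStruct

variable {σ σ' : Type} {ar : σ → ℕ} {ar' : σ' → ℕ}

/-- `f` is a homomorphism from `A` to `B`. -/
def IsHom (A B : RStruct σ ar) (f : A.carrier → B.carrier) : Prop :=
  ∀ s : σ, ∀ t ∈ A.rel s, (f ∘ t) ∈ B.rel s

/-- There exists a homomorphism `A → B`. -/
def Hom (A B : RStruct σ ar) : Prop := ∃ f, IsHom A B f

/-- Homomorphic equivalence. -/
def HomEquiv (A B : RStruct σ ar) : Prop := Hom A B ∧ Hom B A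

/-- `Forb F` : structures admitting no homomorphism from any member of `F`. -/
def Forb (F : Set (RStruct σ ar)) : Set (RStruct σ ar) :=
  {A | ∀ F0 ∈ F, ¬ Hom F0 A}

/-- `CSP D` : structures admitting a homomorphism to some member of `D`. -/
def CSP (D : Set (RStruct σ ar)) : Set (RStruct σ ar) :=
  {A | ∃ D0 ∈ D, Hom A D0}

/-- `A` has a cycle of length `n`: either (degenerate case `n = 1`) a relational tuple with
a repeated coordinate, or (`n ≥ 2`) pairwise distinct elements `x 0, …, x (n-1)` and pairwise
distinct relational tuples `r 0, …, r (n-1)` such that `r i` contains both `x i` and `x (i+1)`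
(indices cyclically, `x n = x 0`). -/
def HasCycleOfLength (A : RStruct σ ar) (n : ℕ) : Prop :=
  (n = 1 ∧ ∃ s : σ, ∃ t ∈ A.rel s, ¬ Function.Injective t) ∨
  (2 ≤ n ∧ ∃ x : ℕ → A.carrier, ∃ r : ℕ → Σ s : σ, Fin (ar s) → A.carrier,
    x n = x 0 ∧
    (∀ i < n, ∀ j < n, x i = x j → i = j) ∧
    (∀ i < n, ∀ j < n, r i = r j → i = j) ∧
    (∀ i < n, (r i).2 ∈ A.rel (r i).1 ∧ (∃ j, (r i).2 j = x i) ∧ (∃ j, (r i).2 j = x (i + 1))))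

def HasCycle (A : RStruct σ ar) : Prop := ∃ n, A.HasCycleOfLength n

/-- A forest is a structure with no cycle. -/
def IsForest (A : RStruct σ ar) : Prop := ¬ A.HasCycle

/-- The shadow (forgetful functor `Φ`) of a structure of the lifted signature `σ ⊕ σ'`:
forget the `σ'`-relations. -/
def shadow (A' : RStruct (σ ⊕ σ') (Sum.elim ar ar')) : RStruct σ ar :=
  ⟨A'.carrier, A'.fin, fun s => A'.rel (Sum.inl s)⟩

/-- The covering condition for lifted structures in which all symbols of `σ'` have the
common arity `r`: every `r`-tuple lies in some `σ'`-relation. -/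
def Covers (r : ℕ) (A' : RStruct (σ ⊕ σ') (Sum.elim ar fun _ => r)) : Prop :=
  ∀ t : Fin r → A'.carrier, ∃ s' : σ', t ∈ A'.rel (Sum.inr s')

end RStruct

open RStruct

namespace RStruct

variable {σ : Type} {ar : σ → ℕ}

/-- Relational tuples over a set `X`. -/
abbrev Tup (ar : σ → ℕ) (X : Type) : Type := Σ s : σ, Fin (ar s) → X

def Tup.map {X Y : Type} (f : X → Y) (t : Tup ar X) : Tup ar Y := ⟨t.1, f ∘ t.2⟩

/-- `x` lies on a tuple of `T` other than `t`. -/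
def Sh {X : Type} (T : Finset (Tup ar X)) (t : Tup ar X) (x : X) : Prop :=
  ∃ u ∈ T, u ≠ t ∧ ∃ k, u.2 k = x

def Leaf {X : Type} (T : Finset (Tup ar X)) (t : Tup ar X) : Prop :=
  ∀ i j, Sh T t (t.2 i) → Sh T t (t.2 j) → t.2 i = t.2 j

def Sparse (l : ℕ) (A : RStruct σ ar) : Prop :=
  ∀ T : Finset (Tup ar A.carrier), (∀ t ∈ T, t.2 ∈ A.rel t.1) → 2 ≤ T.card → T.card ≤ l →
    ∃ t₁ ∈ T, ∃ t₂ ∈ T, t₁ ≠ t₂ ∧ Leaf T t₁ ∧ Leaf T t₂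

def InjTup (A : RStruct σ ar) : Prop := ∀ s, ∀ t ∈ A.rel s, Function.Injective t

def Lifts {K : Type} (A B : RStruct σ ar) (p : B.carrier → A.carrier) (c : B.carrier → K)
    (s : A.carrier → K) : Prop :=
  (∀ a, ∃ b, p b = a ∧ c b = s a) ∧
  ∀ q, ∀ t ∈ A.rel q, ∃ t' ∈ B.rel q, p ∘ t' = t ∧ c ∘ t' = s ∘ t

theorem Lifts.comp {K : Type} {A B C : RStruct σ ar} {p : B.carrier → A.carrier}
    {p' : C.carrier → B.carrier} {c : C.carrier → K} {s' : B.carrier → K} {s : A.carrier → K}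
    (h' : Lifts B C p' c s') (h : Lifts A B p s' s) : Lifts A C (p ∘ p') c s := by
  constructor
  · intro a
    obtain ⟨b, hb, hb'⟩ := h.1 a
    obtain ⟨x, hx, hx'⟩ := h'.1 b
    exact ⟨x, by simp [hx, hb], by rw [hx', hb']⟩
  · intro q t ht
    obtain ⟨t1, h1, h2, h3⟩ := h.2 q t ht
    obtain ⟨t2, h4, h5, h6⟩ := h'.2 q t1 h1
    exact ⟨t2, h4, by rw [Function.comp_assoc, h5, h2], by rw [h6, h3]⟩

theorem Sparse.rooted {l : ℕ} {A : RStruct σ ar} (hA : Sparse l A)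
    (T : Finset (Tup ar A.carrier)) (hT : ∀ t ∈ T, t.2 ∈ A.rel t.1) (hne : T.Nonempty)
    (hl : T.card ≤ l) (P : A.carrier → Prop) (hP : ∀ x y, P x → P y → x = y) :
    ∃ t ∈ T, ∀ i j, (Sh T t (t.2 i) ∨ P (t.2 i)) → (Sh T t (t.2 j) ∨ P (t.2 j)) →
      t.2 i = t.2 j := by
  by_cases h1 : T.card ≤ 1
  · obtain ⟨t, ht⟩ := hne
    have hno : ∀ x, ¬ Sh T t x := by
      rintro x ⟨u, hu, hut, -⟩
      exact hut (Finset.card_le_one.1 h1 _ hu _ ht)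
    refine ⟨t, ht, fun i j hi hj => ?_⟩
    rcases hi with hi | hi
    · exact absurd hi (hno _)
    rcases hj with hj | hj
    · exact absurd hj (hno _)
    exact hP _ _ hi hj
  · obtain ⟨t1, ht1, t2, ht2, hne, hl1, hl2⟩ := hA T hT (by omega) hl
    by_cases hc : ∃ i, P (t1.2 i) ∧ ¬ Sh T t1 (t1.2 i)
    · obtain ⟨i0, hi0, hi0'⟩ := hc
      have hno : ∀ j, ¬ P (t2.2 j) := fun j hj =>
        hi0' ⟨t2, ht2, hne.symm, j, hP _ _ hj hi0⟩
      refine ⟨t2, ht2, fun i j hi hj => ?_⟩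
      exact hl2 i j (hi.resolve_right (hno i)) (hj.resolve_right (hno j))
    · push Not at hc
      refine ⟨t1, ht1, fun i j hi hj => ?_⟩
      exact hl1 i j (hi.elim id (hc i)) (hj.elim id (hc j))

/-! ### Making tuples injective -/

theorem exists_inj (K : Type) [Finite K] [Finite σ] (A : RStruct σ ar) :
    ∃ (B : RStruct σ ar) (p : B.carrier → A.carrier), IsHom B A p ∧ InjTup B ∧
      ∀ c : B.carrier → K, ∃ s, Lifts A B p c s := by
  classical
  have := A.fin
  have := Fintype.ofFinite K
  have := Fintype.ofFinite σ
  let R : ℕ := ∑ s, ar s + 1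
  have hR : ∀ s, ar s ≤ R := fun s =>
    (Finset.single_le_sum (f := ar) (fun _ _ => Nat.zero_le _) (Finset.mem_univ s)).trans
      (Nat.le_succ _)
  let N : ℕ := Fintype.card K * R + 1
  refine ⟨⟨A.carrier × Fin N, inferInstance, fun s => {t | Prod.fst ∘ t ∈ A.rel s ∧
    Function.Injective t}⟩, Prod.fst, fun s t ht => ht.1, fun s t ht => ht.2, fun c => ?_⟩
  have key : ∀ a, ∃ k, ∃ f : Fin R → Fin N, Function.Injective f ∧ ∀ i, c (a, f i) = k := by
    intro a
    obtain ⟨k, hk⟩ := Fintype.exists_lt_card_fiber_of_mul_lt_card (n := R)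
      (fun i : Fin N => c (a, i)) (by simp [N])
    obtain ⟨S, hS, hcard⟩ := Finset.exists_subset_card_eq hk.le
    refine ⟨k, fun i => (S.orderEmbOfFin hcard i), (S.orderEmbOfFin hcard).injective, fun i => ?_⟩
    have := hS (S.orderEmbOfFin_mem hcard i)
    simpa using this
  choose s f hf hs using key
  refine ⟨s, fun a => ⟨(a, f a ⟨0, Nat.succ_pos _⟩), rfl, hs _ _⟩, fun q t ht => ?_⟩
  refine ⟨fun i => (t i, f (t i) (Fin.castLE (hR q) i)), ⟨ht, ?_⟩, rfl, ?_⟩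
  · intro i j hij
    simp only [Prod.mk.injEq] at hij
    obtain ⟨h1, h2⟩ := hij
    rw [h1] at h2
    exact Fin.castLE_injective _ (hf _ h2)
  · funext i
    exact hs _ _

/-! ### Disjoint union of tuples -/

theorem exists_start (K : Type) [Finite σ] (A : RStruct σ ar) (l : ℕ) :
    ∃ (B : RStruct σ ar) (p : B.carrier → A.carrier), IsHom B A p ∧ Sparse l B ∧
      ∀ c : B.carrier → K, (∀ b b', p b = p b' → c b = c b') → ∃ s, Lifts A B p c s := by
  classical
  have := A.fin
  let B : RStruct σ ar := ⟨A.carrier ⊕ (Σ p : Tup ar A.carrier, Fin (ar p.1)), inferInstance,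
    fun s => {t | ∃ t0 ∈ A.rel s, t = fun i => Sum.inr ⟨⟨s, t0⟩, i⟩}⟩
  let p : B.carrier → A.carrier := Sum.elim id (fun x => x.1.2 x.2)
  refine ⟨B, p, ?_, ?_, ?_⟩
  · rintro s t ⟨t0, h0, rfl⟩
    exact h0
  · intro T hT h2 _
    have hleaf : ∀ t ∈ T, Leaf T t := by
      intro t ht i j hi
      exfalso
      obtain ⟨u, hu, hut, k, hk⟩ := hi
      obtain ⟨s, t'⟩ := t
      obtain ⟨s', u'⟩ := u
      obtain ⟨t0, h0, ht0⟩ : ∃ t0 ∈ A.rel s, t' = fun i => Sum.inr ⟨⟨s, t0⟩, i⟩ := hT _ ht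
      obtain ⟨u0, h0', hu0⟩ : ∃ t0 ∈ A.rel s', u' = fun i => Sum.inr ⟨⟨s', t0⟩, i⟩ := hT _ hu
      subst ht0
      subst hu0
      obtain ⟨⟨rfl, h⟩, -⟩ := hk
      exact hut rfl
    obtain ⟨t1, h1, t2, h2, hne⟩ := Finset.one_lt_card.1 h2
    exact ⟨t1, h1, t2, h2, hne, hleaf _ h1, hleaf _ h2⟩
  · intro c hc
    refine ⟨fun a => c (Sum.inl a), fun a => ⟨Sum.inl a, rfl, rfl⟩, fun q t ht => ?_⟩
    refine ⟨_, ⟨t, ht, rfl⟩, rfl, ?_⟩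
    funext i
    exact hc _ _ rfl

/-! ### Amalgamation -/

section amalg

variable {A B : RStruct σ ar} (p : B.carrier → A.carrier) (a : A.carrier) {m : ℕ}
  (φ : {b // p b = a} ≃ Fin m) (H : RStruct Unit (fun _ => m))

open Classical in
noncomputable def inc (e : Tup (fun _ : Unit => m) H.carrier) (b : B.carrier) :
    H.carrier ⊕ (Tup (fun _ : Unit => m) H.carrier × B.carrier) :=
  if h : p b = a then Sum.inl (e.2 (φ ⟨b, h⟩)) else Sum.inr (e, b)

def amalg : RStruct σ ar where
  carrier := H.carrier ⊕ (Tup (fun _ : Unit => m) H.carrier × B.carrier)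
  fin := by
    have := H.fin
    have := B.fin
    infer_instance
  rel s := {t | ∃ e : Tup (fun _ : Unit => m) H.carrier, e.2 ∈ H.rel e.1 ∧
    ∃ t0 ∈ B.rel s, t = inc p a φ H e ∘ t0}

def proj : H.carrier ⊕ (Tup (fun _ : Unit => m) H.carrier × B.carrier) → A.carrier :=
  Sum.elim (fun _ => a) (fun x => p x.2)

theorem proj_inc (e b) : proj p a H (inc p a φ H e b) = p b := by
  unfold inc proj
  split_ifs with h <;> simp [h]

theorem inc_inj (e : Tup (fun _ : Unit => m) H.carrier) (he : Function.Injective e.2) :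
    Function.Injective (inc p a φ H e) := by
  intro x y hxy
  unfold inc at hxy
  split_ifs at hxy with h1 h2 h2
  · have := φ.injective (he (Sum.inl_injective hxy))
    simpa using this
  · simpa using hxy

theorem inc_ne (e e' : Tup (fun _ : Unit => m) H.carrier) (hne : e ≠ e') {x y : B.carrier}
    (hxy : inc p a φ H e x = inc p a φ H e' y) :
    ∃ (hx : p x = a) (hy : p y = a), e.2 (φ ⟨x, hx⟩) = e'.2 (φ ⟨y, hy⟩) := by
  unfold inc at hxy
  split_ifs at hxy with h1 h2 h2
  · exact ⟨h1, h2, Sum.inl_injective hxy⟩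
  · simp [hne] at hxy

theorem amalg_hom (hp : IsHom B A p) : IsHom (amalg p a φ H) A (proj p a H) := by
  rintro s t ⟨e, he, t0, h0, rfl⟩
  have : proj p a H ∘ inc p a φ H e ∘ t0 = p ∘ t0 := by
    funext i
    exact proj_inc p a φ H e _
  exact this ▸ hp s t0 h0

theorem amalg_lifts {K : Type} (e : Tup (fun _ : Unit => m) H.carrier) (he : e.2 ∈ H.rel e.1)
    (c : (amalg p a φ H).carrier → K) (s : A.carrier → K)
    (h : Lifts A B p (fun b => c (inc p a φ H e b)) s) :
    Lifts A (amalg p a φ H) (proj p a H) c s := by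
  constructor
  · intro x
    obtain ⟨b, hb, hb'⟩ := h.1 x
    exact ⟨inc p a φ H e b, by rw [proj_inc, hb], hb'⟩
  · intro q t ht
    obtain ⟨t', h1, h2, h3⟩ := h.2 q t ht
    refine ⟨inc p a φ H e ∘ t', ⟨e, he, t', h1, rfl⟩, ?_, h3⟩
    rw [← h2]
    funext i
    exact proj_inc p a φ H e _

theorem amalg_sparse {l : ℕ} (hp : IsHom B A p) (hA : InjTup A) (hHi : InjTup H)
    (hH : Sparse l H) (hB : Sparse (l + 1) B) : Sparse (l + 1) (amalg p a φ H) := by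
  classical
  intro T hT h2 hl
  have hch : ∀ t : Tup ar (amalg p a φ H).carrier, ∃ (e : Tup (fun _ : Unit => m) H.carrier)
      (t0 : Tup ar B.carrier), t ∈ T → e.2 ∈ H.rel e.1 ∧ t0.2 ∈ B.rel t0.1 ∧
        Tup.map (inc p a φ H e) t0 = t := by
    intro t
    by_cases ht : t ∈ T
    · obtain ⟨e, he, t0, h0, h1⟩ := hT t ht
      refine ⟨e, ⟨t.1, t0⟩, fun _ => ⟨he, h0, ?_⟩⟩
      exact congrArg (Sigma.mk t.1) h1.symm
    · obtain ⟨t1, ht1⟩ : T.Nonempty := Finset.card_pos.1 (by omega)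
      obtain ⟨e, he, t0, h0, h1⟩ := hT t1 ht1
      exact ⟨e, ⟨t1.1, t0⟩, fun h => absurd h ht⟩
  choose ε pre hch using hch
  have hinc : ∀ t ∈ T, Function.Injective (inc p a φ H (ε t)) := fun t ht =>
    inc_inj p a φ H _ (hHi _ _ (hch t ht).1)
  -- leaves of the set of used copies give leaves of `T`
  have main : ∀ e ∈ T.image ε, Leaf (T.image ε) e → ∃ t ∈ T, ε t = e ∧ Leaf T t := by
    intro e he hleaf
    obtain ⟨t1, ht1, he1⟩ := Finset.mem_image.1 he
    have hei : Function.Injective e.2 := he1 ▸ hHi _ _ (hch t1 ht1).1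
    have hei' : Function.Injective (inc p a φ H e) := he1 ▸ hinc t1 ht1
    obtain ⟨t0, ht0, hroot⟩ := hB.rooted ((T.filter (fun t => ε t = e)).image pre)
      (by
        intro t ht
        obtain ⟨u, hu, rfl⟩ := Finset.mem_image.1 ht
        exact (hch u (Finset.mem_filter.1 hu).1).2.1)
      ⟨pre t1, Finset.mem_image_of_mem _ (Finset.mem_filter.2 ⟨ht1, he1⟩)⟩
      (Finset.card_image_le.trans ((Finset.card_filter_le _ _).trans hl))
      (fun b => ∃ hb : p b = a, Sh (T.image ε) e (e.2 (φ ⟨b, hb⟩)))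
      (by
        rintro x y ⟨hx, hx'⟩ ⟨hy, hy'⟩
        have := φ.injective (hei (hleaf _ _ hx' hy'))
        simpa using this)
    obtain ⟨t, ht, hpre⟩ := Finset.mem_image.1 ht0
    obtain ⟨htT, hte⟩ := Finset.mem_filter.1 ht
    refine ⟨t, htT, hte, ?_⟩
    have hmap := (hch t htT).2.2
    rw [hte, hpre] at hmap
    have claim : ∀ i, Sh T t (inc p a φ H e (t0.2 i)) →
        (Sh ((T.filter (fun t => ε t = e)).image pre) t0 (t0.2 i) ∨
          ∃ hb : p (t0.2 i) = a, Sh (T.image ε) e (e.2 (φ ⟨_, hb⟩))) := by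
      rintro i ⟨u, hu, hut, k, hk⟩
      have hu' := (hch u hu).2.2
      obtain ⟨u0, hu0⟩ : ∃ u0, pre u = u0 := ⟨_, rfl⟩
      rw [hu0] at hu'
      obtain ⟨e', he'⟩ : ∃ e', ε u = e' := ⟨_, rfl⟩
      rw [he'] at hu'
      have hk' : ∃ k', inc p a φ H e' (u0.2 k') = inc p a φ H e (t0.2 i) := by
        clear hu0 he'
        subst hu'
        exact ⟨k, hk⟩
      obtain ⟨k', hk'⟩ := hk'
      by_cases hee : e' = e
      · left
        refine ⟨u0, Finset.mem_image.2 ⟨u, Finset.mem_filter.2 ⟨hu, he'.trans hee⟩, hu0⟩, ?_, k', ?_⟩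
        · rintro rfl
          apply hut
          rw [← hu', ← hmap, hee]
        · rw [hee] at hk'
          exact hei' hk'
      · right
        obtain ⟨hx, hy, hxy⟩ := inc_ne p a φ H e' e hee hk'
        exact ⟨hy, e', Finset.mem_image.2 ⟨u, hu, he'⟩, hee, _, hxy⟩
    clear hpre ht htT hte ht0
    subst hmap
    intro i j hi hj
    exact congrArg (inc p a φ H e) (hroot i j (claim i hi) (claim j hj))
  by_cases hE1 : (T.image ε).card ≤ 1
  · -- everything in one copy
    obtain ⟨t1, ht1⟩ : T.Nonempty := Finset.card_pos.1 (by omega)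
    have hall : ∀ t ∈ T, ε t = ε t1 := fun t ht => Finset.card_le_one.1 hE1 _
      (Finset.mem_image_of_mem _ ht) _ (Finset.mem_image_of_mem _ ht1)
    have hpinj : Set.InjOn pre T := by
      intro t ht u hu htu
      rw [← (hch t ht).2.2, ← (hch u hu).2.2, htu, hall t ht, hall u hu]
    have hc : (T.image pre).card = T.card := Finset.card_image_of_injOn hpinj
    obtain ⟨x, hx, y, hy, hxy, hlx, hly⟩ := hB (T.image pre)
      (by
        intro t ht
        obtain ⟨u, hu, rfl⟩ := Finset.mem_image.1 ht
        exact (hch u hu).2.1) (by omega) (by omega)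
    have back : ∀ x ∈ T.image pre, Leaf (T.image pre) x →
        Tup.map (inc p a φ H (ε t1)) x ∈ T ∧ Leaf T (Tup.map (inc p a φ H (ε t1)) x) := by
      intro x hx hlx
      obtain ⟨t, ht, htx⟩ := Finset.mem_image.1 hx
      have hm := (hch t ht).2.2
      rw [hall t ht, htx] at hm
      refine ⟨hm ▸ ht, ?_⟩
      have claim : ∀ i, Sh T (Tup.map (inc p a φ H (ε t1)) x) (inc p a φ H (ε t1) (x.2 i)) →
          Sh (T.image pre) x (x.2 i) := by
        rintro i ⟨u, hu, hut, k, hk⟩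
        have hu' := (hch u hu).2.2
        rw [hall u hu] at hu'
        have hk' : ∃ k', inc p a φ H (ε t1) ((pre u).2 k') = inc p a φ H (ε t1) (x.2 i) := by
          generalize pre u = u0 at hu'
          generalize ε t1 = e at *
          subst hu'
          exact ⟨k, hk⟩
        obtain ⟨k', hk'⟩ := hk'
        refine ⟨pre u, Finset.mem_image_of_mem _ hu, ?_, k', hinc t1 ht1 hk'⟩
        intro h
        subst h
        exact hut hu'.symm
      intro i j hi hj
      exact congrArg (inc p a φ H (ε t1)) (hlx i j (claim i hi) (claim j hj))
    obtain ⟨hx1, hx2⟩ := back x hx hlx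
    obtain ⟨hy1, hy2⟩ := back y hy hly
    refine ⟨_, hx1, _, hy1, ?_, hx2, hy2⟩
    intro h
    apply hxy
    obtain ⟨t, ht, htx⟩ := Finset.mem_image.1 hx
    obtain ⟨u, hu, huy⟩ := Finset.mem_image.1 hy
    have e1 := (hch t ht).2.2
    rw [hall t ht, htx] at e1
    have e2 := (hch u hu).2.2
    rw [hall u hu, huy] at e2
    rw [← htx, ← huy, ← e1, ← e2, h]
  · by_cases hE2 : (T.image ε).card ≤ l
    · obtain ⟨e1, he1, e2, he2, hne, hl1, hl2⟩ := hH (T.image ε)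
        (by
          intro e he
          obtain ⟨u, hu, rfl⟩ := Finset.mem_image.1 he
          exact (hch u hu).1) (by omega) hE2
      obtain ⟨t1, ht1, rfl, hh1⟩ := main e1 he1 hl1
      obtain ⟨t2, ht2, rfl, hh2⟩ := main e2 he2 hl2
      exact ⟨t1, ht1, t2, ht2, fun h => hne (by rw [h]), hh1, hh2⟩
    · -- all tuples in different copies
      have hcard : (T.image ε).card = T.card := le_antisymm Finset.card_image_le (by omega)
      have hinj : Set.InjOn ε T := Finset.card_image_iff.1 hcard
      have hleaf : ∀ t ∈ T, Leaf T t := by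
        intro t ht
        have hm := (hch t ht).2.2
        have hr := (hch t ht).2.1
        obtain ⟨t0, hpre⟩ : ∃ t0, pre t = t0 := ⟨_, rfl⟩
        obtain ⟨e, he⟩ : ∃ e, ε t = e := ⟨_, rfl⟩
        rw [hpre] at hr
        rw [hpre, he] at hm
        have claim : ∀ i, Sh T t (inc p a φ H e (t0.2 i)) → p (t0.2 i) = a := by
          rintro i ⟨u, hu, hut, k, hk⟩
          have hu' := (hch u hu).2.2
          have hne : ε u ≠ e := fun h => hut (hinj hu ht (h.trans he.symm))
          generalize pre u = u0 at hu'
          generalize ε u = e' at *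
          have hk' : ∃ k', inc p a φ H e' (u0.2 k') = inc p a φ H e (t0.2 i) := by
            subst hu'
            exact ⟨k, hk⟩
          obtain ⟨k', hk'⟩ := hk'
          exact (inc_ne p a φ H e' e hne hk').2.1
        clear hpre he
        subst hm
        intro i j hi hj
        have h1 := claim i hi
        have h2 := claim j hj
        have : i = j := hA _ _ (hp _ _ hr) (h1.trans h2.symm)
        rw [this]
      obtain ⟨t1, h1, t2, h2, hne⟩ := Finset.one_lt_card.1 (show 1 < T.card by omega)
      exact ⟨t1, h1, t2, h2, hne, hleaf _ h1, hleaf _ h2⟩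

end amalg

theorem partite (K : Type) [Finite σ] (A : RStruct σ ar) (hA : InjTup A) (l : ℕ)
    (hyp : ∀ m : ℕ, ∃ H : RStruct Unit (fun _ => m), InjTup H ∧ Sparse l H ∧
      ∀ c : H.carrier → K, ∃ t ∈ H.rel (), ∀ i j, c (t i) = c (t j)) (S : Finset A.carrier) :
    ∃ (B : RStruct σ ar) (p : B.carrier → A.carrier), IsHom B A p ∧ Sparse (l + 1) B ∧
      ∀ c : B.carrier → K, (∀ b b', p b = p b' → p b ∉ S → c b = c b') →
        ∃ s, Lifts A B p c s := by
  classical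
  induction S using Finset.induction_on with
  | empty =>
    obtain ⟨B, p, h1, h2, h3⟩ := exists_start K A (l + 1)
    exact ⟨B, p, h1, h2, fun c hc => h3 c fun b b' h => hc b b' h (by simp)⟩
  | insert a S ha ih =>
    obtain ⟨B, p, hp, hB, hlift⟩ := ih
    have := B.fin
    obtain ⟨H, hHi, hHs, hHc⟩ := hyp (Nat.card {b // p b = a})
    let φ : {b // p b = a} ≃ Fin (Nat.card {b // p b = a}) := Finite.equivFin _
    refine ⟨amalg p a φ H, proj p a H, amalg_hom p a φ H hp,
      amalg_sparse p a φ H hp hA hHi hHs hB, fun c hc => ?_⟩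
    obtain ⟨t, ht, hmono⟩ := hHc (fun h => c (Sum.inl h))
    obtain ⟨s, hs⟩ := hlift (fun b => c (inc p a φ H ⟨(), t⟩ b)) (by
      intro b b' hbb hb
      by_cases hba : p b = a
      · have hba' : p b' = a := hbb ▸ hba
        unfold inc
        simp only [hba, hba', dif_pos]
        exact hmono _ _
      · apply hc
        · rw [proj_inc, proj_inc, hbb]
        · rw [proj_inc]
          simp [hba, hb])
    exact ⟨s, amalg_lifts p a φ H ⟨(), t⟩ ht c s hs⟩

theorem sparse_lemma (K : Type) [Finite K] (l : ℕ) :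
    ∀ (σ : Type) [Finite σ] (ar : σ → ℕ) (A : RStruct σ ar),
    ∃ (B : RStruct σ ar) (p : B.carrier → A.carrier), IsHom B A p ∧ InjTup B ∧ Sparse l B ∧
      ∀ c : B.carrier → K, ∃ s, Lifts A B p c s := by
  classical
  induction l with
  | zero =>
    intro σ _ ar A
    obtain ⟨B, p, h1, h2, h3⟩ := exists_inj K A
    exact ⟨B, p, h1, h2, fun T _ h h' => by omega, h3⟩
  | succ l ih =>
    intro σ _ ar A
    obtain ⟨A1, p1, h1, h2, h3⟩ := exists_inj K A
    have hyp : ∀ m : ℕ, ∃ H : RStruct Unit (fun _ => m), InjTup H ∧ Sparse l H ∧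
        ∀ c : H.carrier → K, ∃ t ∈ H.rel (), ∀ i j, c (t i) = c (t j) := by
      intro m
      obtain ⟨H, p, g1, g2, g3, g4⟩ := ih Unit (fun _ => m) ⟨Unit, inferInstance, fun _ => Set.univ⟩
      refine ⟨H, g2, g3, fun c => ?_⟩
      obtain ⟨s, hs⟩ := g4 c
      obtain ⟨t, ht, -, ht'⟩ := hs.2 () (fun _ => ()) (Set.mem_univ _)
      refine ⟨t, ht, fun i j => ?_⟩
      exact (congrFun ht' i).trans (congrFun ht' j).symm
    have := A1.fin
    have := Fintype.ofFinite A1.carrier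
    obtain ⟨B, p, g1, g2, g3⟩ := partite K A1 h2 l hyp Finset.univ
    refine ⟨B, p1 ∘ p, fun s t ht => h1 s _ (g1 s t ht), ?_, g2, fun c => ?_⟩
    · intro s t ht
      exact (h2 s _ (g1 s t ht)).of_comp
    · obtain ⟨s', hs'⟩ := g3 c (fun b b' _ h => absurd (Finset.mem_univ _) h)
      obtain ⟨s, hs⟩ := h3 s'
      exact ⟨s, hs'.comp hs⟩

theorem Sparse.no_cycle {l n : ℕ} {A : RStruct σ ar} (hA : Sparse l A) (hi : InjTup A)
    (hn : n ≤ l) : ¬ A.HasCycleOfLength n := by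
  classical
  rintro (⟨-, s, t, ht, hti⟩ | ⟨h2, x, r, hx, hxi, hri, hr⟩)
  · exact hti (hi s t ht)
  · have hc : ((Finset.range n).image r).card = n := by
      rw [Finset.card_image_of_injOn, Finset.card_range]
      intro i hi j hj
      exact hri i (by simpa using hi) j (by simpa using hj)
    obtain ⟨t, ht, -, -, -, hleaf, -⟩ := hA ((Finset.range n).image r) (by
      intro t ht
      obtain ⟨i, hi, rfl⟩ := Finset.mem_image.1 ht
      exact (hr i (by simpa using hi)).1) (by omega) (by omega)
    obtain ⟨i, hi, rfl⟩ := Finset.mem_image.1 ht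
    have hin : i < n := by simpa using hi
    obtain ⟨-, ⟨j, hj⟩, ⟨k, hk⟩⟩ := hr i hin
    have s1 : Sh ((Finset.range n).image r) (r i) ((r i).2 j) := by
      rw [hj]
      rcases Nat.eq_zero_or_pos i with h0 | h0
      · refine ⟨r (n - 1), Finset.mem_image_of_mem _ (by simp; omega), fun h => ?_, ?_⟩
        · have := hri (n - 1) (by omega) i hin h
          omega
        · obtain ⟨-, -, k', hk'⟩ := hr (n - 1) (by omega)
          rw [Nat.sub_add_cancel (by omega), hx] at hk'
          exact ⟨k', by rw [hk', h0]⟩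
      · refine ⟨r (i - 1), Finset.mem_image_of_mem _ (by simp; omega), fun h => ?_, ?_⟩
        · have := hri (i - 1) (by omega) i hin h
          omega
        · obtain ⟨-, -, k', hk'⟩ := hr (i - 1) (by omega)
          rw [Nat.sub_add_cancel (by omega)] at hk'
          exact ⟨k', hk'⟩
    have s2 : Sh ((Finset.range n).image r) (r i) ((r i).2 k) := by
      rw [hk]
      by_cases h0 : i + 1 = n
      · refine ⟨r 0, Finset.mem_image_of_mem _ (by simp; omega), fun h => ?_, ?_⟩
        · have := hri 0 (by omega) i hin h
          omega
        · obtain ⟨-, ⟨k', hk'⟩, -⟩ := hr 0 (by omega)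
          exact ⟨k', by rw [hk', h0, hx]⟩
      · refine ⟨r (i + 1), Finset.mem_image_of_mem _ (by simp; omega), fun h => ?_, ?_⟩
        · have := hri (i + 1) (by omega) i hin h
          omega
        · obtain ⟨-, ⟨k', hk'⟩, -⟩ := hr (i + 1) (by omega)
          exact ⟨k', hk'⟩
    have heq := hleaf j k s1 s2
    rw [hj, hk] at heq
    by_cases h0 : i + 1 = n
    · rw [h0, hx] at heq
      have := hxi i hin 0 (by omega) heq
      omega
    · have := hxi i hin (i + 1) (by omega) heq
      omega

/-- The image of a small structure in a sparse structure is a forest. -/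
theorem image_forest {l : ℕ} {A B : RStruct σ ar} (hB : Sparse l B) (hi : InjTup B)
    (f : A.carrier → B.carrier) (hf : IsHom A B f) (hl : Nat.card A.carrier ≤ l) :
    ∃ T : RStruct σ ar, T.IsForest ∧ Hom A T ∧ Hom T B := by
  have := A.fin
  refine ⟨⟨Set.range f, inferInstance, fun s => {t | Subtype.val ∘ t ∈ B.rel s}⟩, ?_,
    ⟨fun x => ⟨f x, x, rfl⟩, fun s t ht => hf s t ht⟩, ⟨Subtype.val, fun s t ht => ht⟩⟩
  rintro ⟨n, hn⟩
  rcases hn with ⟨-, s, t, ht, hti⟩ | ⟨h2, x, r, hx, hxi, hri, hr⟩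
  · exact hti (hi s _ ht).of_comp
  · have hnl : n ≤ l := by
      refine le_trans ?_ hl
      have h1 : Nat.card (Fin n) ≤ Nat.card (Set.range f) :=
        Nat.card_le_card_of_injective (fun i : Fin n => x i)
          (fun i j h => Fin.ext (hxi i i.2 j j.2 h))
      have h2 : Nat.card (Set.range f) ≤ Nat.card A.carrier :=
        Nat.card_le_card_of_surjective (Set.rangeFactorization f) Set.rangeFactorization_surjective
      simpa using h1.trans h2
    have hmapinj : Function.Injective
        (Tup.map (ar := ar) (Subtype.val : Set.range f → B.carrier)) := by
      rintro ⟨s, t⟩ ⟨s', t'⟩ h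
      unfold Tup.map at h
      simp only [Sigma.mk.injEq] at h
      obtain ⟨rfl, h⟩ := h
      have : t = t' := Subtype.val_injective.comp_left (eq_of_heq h)
      rw [this]
    refine hB.no_cycle hi hnl (Or.inr ⟨h2, fun i => (x i).1, fun i => Tup.map Subtype.val (r i),
      congrArg _ hx, fun i hi j hj h => hxi i hi j hj (Subtype.ext h),
      fun i hi j hj h => hri i hi j hj (hmapinj h), fun i hi => ?_⟩)
    obtain ⟨h1, ⟨j, hj⟩, ⟨k, hk⟩⟩ := hr i hi
    exact ⟨h1, ⟨j, congrArg Subtype.val hj⟩, ⟨k, congrArg Subtype.val hk⟩⟩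

theorem Hom.trans {A B C : RStruct σ ar} (h : Hom A B) (h' : Hom B C) : Hom A C := by
  obtain ⟨f, hf⟩ := h
  obtain ⟨g, hg⟩ := h'
  exact ⟨g ∘ f, fun s t ht => hg s _ (hf s t ht)⟩

theorem Hom.refl (A : RStruct σ ar) : Hom A A := ⟨id, fun _ _ ht => ht⟩

theorem exists_sparse [Finite σ] (D : Set (RStruct σ ar)) (hD : D.Finite) (A : RStruct σ ar)
    (hAD : A ∉ CSP D) (l : ℕ) :
    ∃ B : RStruct σ ar, Hom B A ∧ InjTup B ∧ Sparse l B ∧ B ∉ CSP D := by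
  classical
  obtain ⟨k, hk⟩ : ∃ k : ℕ, ∀ X ∈ D, Nat.card X.carrier ≤ k := by
    obtain ⟨k, hk⟩ := (hD.image (fun X => Nat.card X.carrier)).bddAbove
    exact ⟨k, fun X hX => hk (Set.mem_image_of_mem _ hX)⟩
  obtain ⟨B, p, h1, h2, h3, h4⟩ := sparse_lemma (Fin k) l σ ar A
  refine ⟨B, ⟨p, h1⟩, h2, h3, ?_⟩
  rintro ⟨X, hX, g, hg⟩
  apply hAD
  refine ⟨X, hX, ?_⟩
  have := X.fin
  let θ : X.carrier → Fin k := fun x => Fin.castLE (hk X hX) (Finite.equivFin X.carrier x)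
  have hθ : Function.Injective θ :=
    (Fin.castLE_injective _).comp (Finite.equivFin X.carrier).injective
  obtain ⟨s, hs1, hs2⟩ := h4 (θ ∘ g)
  have : ∀ a, ∃ x, θ x = s a := fun a => by
    obtain ⟨b, -, hb⟩ := hs1 a
    exact ⟨g b, hb⟩
  choose f hf using this
  refine ⟨f, fun q t ht => ?_⟩
  obtain ⟨t', ht', -, hc⟩ := hs2 q t ht
  have : f ∘ t = g ∘ t' := by
    funext i
    apply hθ
    exact (hf (t i)).trans (congrFun hc i).symm
  rw [this]
  exact hg q t' ht'

end RStruct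

/-- if `(F, D)` is a finite duality in `Rel(Δ)`, then there is a finite set `F₀`
of relational forests with `Forb F₀ = Forb F`. -/
theorem duality_lhs_is_forests {σ : Type} [Finite σ] {ar : σ → ℕ}
    (F D : Set (RStruct σ ar)) (hF : F.Finite) (hD : D.Finite)
    (hdual : Forb F = CSP D) :
    ∃ F₀ : Set (RStruct σ ar), F₀.Finite ∧ (∀ A ∈ F₀, A.IsForest) ∧ Forb F₀ = Forb F := by
  obtain ⟨l, hl⟩ : ∃ l : ℕ, ∀ X ∈ F, Nat.card X.carrier ≤ l := by
    obtain ⟨k, hk⟩ := (hF.image (fun X => Nat.card X.carrier)).bddAbove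
    exact ⟨k, fun X hX => hk (Set.mem_image_of_mem _ hX)⟩
  have key : ∀ X : RStruct σ ar, ∃ T : RStruct σ ar, X ∈ F →
      T.IsForest ∧ Hom T X ∧ ∃ Y ∈ F, Hom Y T := by
    intro X
    by_cases hX : X ∈ F
    · have hXD : X ∉ CSP D := by
        rw [← hdual]
        exact fun h => h X hX (Hom.refl X)
      obtain ⟨B, hBX, hBi, hBs, hBD⟩ := exists_sparse D hD X hXD l
      rw [← hdual] at hBD
      simp only [Forb, Set.mem_ofPred_eq, not_forall, not_not] at hBD
      obtain ⟨Y, hY, f, hf⟩ := hBD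
      obtain ⟨T, hT, hYT, hTB⟩ := image_forest hBs hBi f hf (hl Y hY)
      exact ⟨T, fun _ => ⟨hT, hTB.trans hBX, Y, hY, hYT⟩⟩
    · exact ⟨X, fun h => absurd h hX⟩
  choose T hT using key
  refine ⟨T '' F, hF.image T, ?_, ?_⟩
  · rintro _ ⟨X, hX, rfl⟩
    exact (hT X hX).1
  · ext A
    constructor
    · intro hA X hX h
      exact hA (T X) ⟨X, hX, rfl⟩ ((hT X hX).2.1.trans h)
    · rintro hA _ ⟨X, hX, rfl⟩ h
      obtain ⟨Y, hY, hYT⟩ := (hT X hX).2.2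
      exact hA Y hY (hYT.trans h)
end

section
/- (Sparse Incomparability Lemma) Let k and ℓ be positive integers and let A be a finite relational structure of type Δ. Then there exists a finite structure B of type Δ such that: (1) there exists a homomorphism B → A; (2) for every structure C of type Δ with at most k elements, there exists a homomorphism A → C if and only if there exists a homomorphism B → C; and (3) B has girth at least ℓ (i.e. B contains no cycle of length less than ℓ). -/
open RStruct

/-- Pigeonhole. -/
theorem sil_pigeon {C : Type} [Finite C] (k R : ℕ) (hC : Nat.card C ≤ k)
    (f : Fin (k * R + 1) → C) :
    ∃ c : C, ∃ φ : Fin R → Fin (k * R + 1), Function.Injective φ ∧ ∀ i, f (φ i) = c := by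
  classical
  have := Fintype.ofFinite C
  rw [Nat.card_eq_fintype_card] at hC
  have h : Fintype.card C * R < Fintype.card (Fin (k * R + 1)) := by
    rw [Fintype.card_fin]
    have := Nat.mul_le_mul_right R hC
    omega
  obtain ⟨c, hc⟩ := Fintype.exists_lt_card_fiber_of_mul_lt_card f h
  refine ⟨c, ?_⟩
  obtain ⟨T, hT, hTc⟩ := Finset.exists_subset_card_eq hc.le
  refine ⟨fun i => T.orderEmbOfFin hTc i, (T.orderEmbOfFin hTc).injective, fun i => ?_⟩
  have := hT (T.orderEmbOfFin_mem hTc i)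
  simpa using this

/-- Closed edge sequences in an incidence system without short cycles. -/
theorem sil_closed {W E : Type} (I : W → E → Prop) (g : ℕ)
    (hI : ∀ m, 2 ≤ m → m < g → ∀ (x : ℕ → W) (r : ℕ → E), x m = x 0 →
      (∀ i < m, ∀ j < m, x i = x j → i = j) → (∀ i < m, ∀ j < m, r i = r j → i = j) →
      (∀ i < m, I (x i) (r i) ∧ I (x (i + 1)) (r i)) → False) :
    ∀ n, n ≤ g → ∀ (e : ℕ → E) (v : ℕ → W), e n = e 0 →
      (∀ i < n, ∀ j < n, v i = v j → i = j) →
      (∀ i < n, e i = e (i + 1) ∨ (I (v i) (e i) ∧ I (v i) (e (i + 1)))) →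
      (∀ i ≤ n, e i = e 0) ∨ (∀ i < n, ∀ j < n, e i = e j → i = j) := by
  intro n
  induction n using Nat.strong_induction_on with
  | _ n ih =>
  intro hn e v hcl hv hinc
  -- shorter sequences are constant
  have key : ∀ m < n, ∀ (e : ℕ → E) (v : ℕ → W), e m = e 0 →
      (∀ i < m, ∀ j < m, v i = v j → i = j) →
      (∀ i < m, e i = e (i + 1) ∨ (I (v i) (e i) ∧ I (v i) (e (i + 1)))) →
      (∀ i ≤ m, e i = e 0) := by
    intro m hm e v hcl hv hinc
    rcases ih m hm (by omega) e v hcl hv hinc with h | h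
    · exact h
    · by_cases hm2 : 2 ≤ m
      · exfalso
        have hne : ∀ i < m, e i ≠ e (i + 1) := by
          intro i hi hh
          by_cases h1 : i + 1 < m
          · have := h i hi (i + 1) h1 hh
            omega
          · have h2 : i + 1 = m := by omega
            rw [h2, hcl] at hh
            have := h i hi 0 (by omega) hh
            omega
        refine hI m hm2 (by omega) (fun i => if i = m then v 0 else v i) (fun i => e (i + 1))
          ?_ ?_ ?_ ?_
        · simp
        · intro i hi j hj hij
          simp only [hi.ne, hj.ne, if_false] at hij
          exact hv i hi j hj hij
        · intro i hi j hj hij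
          by_cases h1 : i + 1 < m <;> by_cases h2 : j + 1 < m
          · have := h _ h1 _ h2 hij
            omega
          · have h2' : j + 1 = m := by omega
            simp only [h2', hcl] at hij
            have := h _ h1 0 (by omega) hij
            omega
          · have h2' : i + 1 = m := by omega
            simp only [h2', hcl] at hij
            have := h 0 (by omega) _ h2 hij
            omega
          · omega
        · intro i hi
          have hi1 := (hinc i hi).resolve_left (hne i hi)
          refine ⟨by simpa [hi.ne] using hi1.2, ?_⟩
          by_cases h1 : i + 1 < m
          · have hi2 := (hinc _ h1).resolve_left (hne _ h1)
            simpa [h1.ne] using hi2.1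
          · have h2 : i + 1 = m := by omega
            have hi2 := (hinc 0 (by omega)).resolve_left (hne 0 (by omega))
            simpa [h2, hcl] using hi2.1
      · intro i hi
        have : i = 0 ∨ i = m := by omega
        rcases this with rfl | rfl
        · rfl
        · exact hcl
  by_cases hinj : ∀ i < n, ∀ j < n, e i = e j → i = j
  · exact Or.inr hinj
  left
  have : ∃ i j, i < j ∧ j < n ∧ e i = e j := by
    push Not at hinj
    obtain ⟨i, hi, j, hj, hij, hne⟩ := hinj
    rcases lt_or_gt_of_ne hne with h | h
    · exact ⟨i, j, h, hj, hij⟩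
    · exact ⟨j, i, h, hi, hij.symm⟩
  obtain ⟨i, j, hij, hj, heq⟩ := this
  have h1 := key (j - i) (by omega) (fun l => e (i + l)) (fun l => v (i + l))
    (by simp only [Nat.add_sub_cancel' hij.le, add_zero, heq])
    (fun a ha b hb hab => by
      have := hv _ (by omega) _ (by omega) hab
      omega)
    (fun a ha => hinc (i + a) (by omega))
  have h2 := key (n - (j - i)) (by omega) (fun l => if l ≤ i then e l else e (l + (j - i)))
    (fun l => if l < i then v l else v (l + (j - i)))
    (by
      have a1 : ¬ (n - (j - i) ≤ i) := by omega
      have a2 : n - (j - i) + (j - i) = n := by omega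
      simp [a1, a2, hcl])
    (fun a ha b hb hab => by
      try dsimp only at hab
      split_ifs at hab with c1 c2 c2
      · exact hv _ (by omega) _ (by omega) hab
      · have := hv _ (by omega) _ (by omega) hab
        omega
      · have := hv _ (by omega) _ (by omega) hab
        omega
      · have := hv _ (by omega) _ (by omega) hab
        omega)
    (fun a ha => by
      rcases lt_trichotomy a i with h | h | h
      · have b1 : a ≤ i := by omega
        have b2 : a + 1 ≤ i := by omega
        simp only [h, b1, b2, if_true]
        exact hinc a (by omega)
      · subst h
        have b2 : ¬ (a + 1 ≤ a) := by omega
        have b3 : a + (j - a) = j := by omega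
        have b4 : a + 1 + (j - a) = j + 1 := by omega
        simp only [le_refl, lt_irrefl, b2, b3, b4, if_true, if_false, heq]
        exact hinc j hj
      · have b0 : ¬ (a < i) := by omega
        have b1 : ¬ (a ≤ i) := by omega
        have b2 : ¬ (a + 1 ≤ i) := by omega
        have b4 : a + 1 + (j - i) = a + (j - i) + 1 := by omega
        simp only [b0, b1, b2, b4, if_false]
        exact hinc _ (by omega))
  have h2' : ∀ l ≤ n - (j - i), (if l ≤ i then e l else e (l + (j - i))) = e 0 := by
    intro l hl
    simpa using h2 l hl
  have hi0 : e i = e 0 := by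
    have := h2' i (by omega)
    simpa using this
  intro l hl
  by_cases c1 : l ≤ i
  · have := h2' l (by omega)
    simpa [c1] using this
  · by_cases c2 : l ≤ j
    · have := h1 (l - i) (by omega)
      have c3 : i + (l - i) = l := by omega
      simp only [c3, add_zero] at this
      rw [this, hi0]
    · have := h2' (l - (j - i)) (by omega)
      have c3 : ¬ (l - (j - i) ≤ i) := by omega
      have c4 : l - (j - i) + (j - i) = l := by omega
      simpa [c3, c4] using this

namespace RStruct

/-- All relational tuples are injective. -/
def InjTuples {σ : Type} {ar : σ → ℕ} (A : RStruct σ ar) : Prop :=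
  ∀ s, ∀ t ∈ A.rel s, Function.Injective t

/-- The statement proved by induction on `g`. -/
def SilStmt (g : ℕ) : Prop :=
  ∀ (σ : Type) (_ : Finite σ) (ar : σ → ℕ) (k : ℕ) (A : RStruct σ ar), A.InjTuples →
    ∃ B : RStruct σ ar, Hom B A ∧
      (∀ C : RStruct σ ar, Nat.card C.carrier ≤ k → Hom B C → Hom A C) ∧
      (∀ n ≤ g, ¬ B.HasCycleOfLength n)

/-- Hypergraphs of large chromatic number without short cycles. -/
theorem sil_hyper (g : ℕ) (hg : 1 ≤ g) (hS : SilStmt g) (F : Type) [Finite F] (k : ℕ) :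
    ∃ (V : Type) (_ : Finite V) (E : Set (F → V)), (∀ e ∈ E, Function.Injective e) ∧
      (∀ C : Type, Finite C → Nat.card C ≤ k → ∀ c : V → C, ∃ e ∈ E, ∀ i j, c (e i) = c (e j)) ∧
      (∀ m, 2 ≤ m → m ≤ g → ∀ (x : ℕ → V) (r : ℕ → E), x m = x 0 →
        (∀ i < m, ∀ j < m, x i = x j → i = j) → (∀ i < m, ∀ j < m, r i = r j → i = j) →
        (∀ i < m, (∃ j, (r i).1 j = x i) ∧ (∃ j, (r i).1 j = x (i + 1))) → False) := by
  obtain ⟨m, ⟨eF⟩⟩ := Finite.exists_equiv_fin F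
  let A : RStruct Unit (fun _ => m) :=
    ⟨Fin (k * m + 1), inferInstance, fun _ => {t | Function.Injective t}⟩
  obtain ⟨B, -, hBC, hcyc⟩ := hS Unit inferInstance (fun _ => m) k A (fun s t ht => ht)
  have hinj : ∀ t ∈ B.rel (), Function.Injective t := by
    intro t ht
    by_contra hcon
    exact hcyc 1 hg (Or.inl ⟨rfl, (), t, ht, hcon⟩)
  refine ⟨B.carrier, B.fin, {e | e ∘ eF.symm ∈ B.rel ()}, ?_, ?_, ?_⟩
  · intro e he
    have := hinj _ he
    have h2 := this.comp eF.injective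
    rwa [Function.comp_assoc, Equiv.symm_comp_self, Function.comp_id] at h2
  · intro C hCf hC c
    let C' : RStruct Unit (fun _ => m) := ⟨C, hCf, fun _ => {t | ∃ i j, t i ≠ t j}⟩
    have hno : ¬ Hom A C' := by
      rintro ⟨f, hf⟩
      obtain ⟨c, φ, hφ, hφc⟩ := sil_pigeon k m hC f
      obtain ⟨i, j, hij⟩ := hf () φ hφ
      exact hij ((hφc i).trans (hφc j).symm)
    have hnB : ¬ IsHom B C' c := fun h => hno (hBC C' hC ⟨c, h⟩)
    unfold IsHom at hnB
    push Not at hnB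
    obtain ⟨s, t, ht, htc⟩ := hnB
    refine ⟨t ∘ eF, ?_, ?_⟩
    · change (t ∘ eF) ∘ eF.symm ∈ B.rel ()
      rw [Function.comp_assoc, Equiv.self_comp_symm, Function.comp_id]
      exact ht
    · intro i j
      by_contra hij
      exact htc ⟨eF i, eF j, hij⟩
  · intro n hn2 hng x r hx hxi hri hinc
    refine hcyc n hng (Or.inr ⟨hn2, x, fun i => ⟨(), (r i).1 ∘ eF.symm⟩, hx, hxi, ?_, ?_⟩)
    · intro i hi j hj hij
      apply hri i hi j hj
      have h1 : (r i).1 ∘ eF.symm = (r j).1 ∘ eF.symm := by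
        simpa using hij
      apply Subtype.ext
      exact eF.symm.surjective.injective_comp_right h1
    · intro i hi
      obtain ⟨⟨j, hj⟩, ⟨j', hj'⟩⟩ := hinc i hi
      exact ⟨(r i).2, ⟨eF j, by simpa using hj⟩, ⟨eF j', by simpa using hj'⟩⟩

section amalgam
variable {σ : Type} {ar : σ → ℕ}

/-- Copy map into the amalgam. -/
noncomputable def silCopy {P A V : Type} (π : P → A) (a : A) (E : Set ({p // π p = a} → V)) (e : E)
    (p : P) : V ⊕ (E × {p // π p ≠ a}) :=
  open Classical in
  if h : π p = a then Sum.inl (e.1 ⟨p, h⟩) else Sum.inr (e, ⟨p, h⟩)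

theorem silCopy_inj {P A V : Type} (π : P → A) (a : A) (E : Set ({p // π p = a} → V))
    (hE : ∀ e ∈ E, Function.Injective e) (e : E) : Function.Injective (silCopy π a E e) := by
  intro p q h
  unfold silCopy at h
  split_ifs at h with h1 h2 h2
  · have := hE _ e.2 (Sum.inl.inj h)
    simpa using this
  · simpa using h

theorem silCopy_ne {P A V : Type} (π : P → A) (a : A) (E : Set ({p // π p = a} → V))
    (e e' : E) (hne : e ≠ e') (p p' : P) (h : silCopy π a E e p = silCopy π a E e' p') :
    π p = a ∧ ∃ v, silCopy π a E e p = Sum.inl v ∧ (∃ j, e.1 j = v) ∧ (∃ j, e'.1 j = v) := by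
  unfold silCopy at h ⊢
  split_ifs at h ⊢ with h1 h2 h2
  · exact ⟨h1, _, rfl, ⟨_, rfl⟩, ⟨_, (Sum.inl.inj h).symm⟩⟩
  · simp at h
    exact absurd h.1 hne

/-- Projection of the amalgam. -/
def silProj {P A V : Type} (π : P → A) (a : A) (E : Set ({p // π p = a} → V)) :
    V ⊕ (E × {p // π p ≠ a}) → A :=
  Sum.elim (fun _ => a) (fun q => π q.2.1)

theorem silProj_copy {P A V : Type} (π : P → A) (a : A) (E : Set ({p // π p = a} → V)) (e : E)
    (p : P) : silProj π a E (silCopy π a E e p) = π p := by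
  unfold silCopy silProj
  split_ifs with h
  · simp [h]
  · simp

/-- Amalgam of copies of `P`. -/
noncomputable def silAmalgam (P A : RStruct σ ar) (π : P.carrier → A.carrier) (a : A.carrier)
    (V : Type) (hV : Finite V) (E : Set ({p // π p = a} → V)) : RStruct σ ar where
  carrier := V ⊕ (E × {p // π p ≠ a})
  fin := by
    have := P.fin
    infer_instance
  rel s := {t | ∃ e : E, ∃ q ∈ P.rel s, t = silCopy π a E e ∘ q}

theorem silAmalgam_cycle (P A : RStruct σ ar) (hA : A.InjTuples) (π : P.carrier → A.carrier)
    (hπ : IsHom P A π) (a : A.carrier)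
    (V : Type) (hV : Finite V) (E : Set ({p // π p = a} → V))
    (hE : ∀ e ∈ E, Function.Injective e) (g : ℕ)
    (hcyc : ∀ m, 2 ≤ m → m ≤ g → ∀ (x : ℕ → V) (r : ℕ → E), x m = x 0 →
        (∀ i < m, ∀ j < m, x i = x j → i = j) → (∀ i < m, ∀ j < m, r i = r j → i = j) →
        (∀ i < m, (∃ j, (r i).1 j = x i) ∧ (∃ j, (r i).1 j = x (i + 1))) → False)
    (hP : ∀ n ≤ g + 1, ¬ P.HasCycleOfLength n) :
    ∀ n ≤ g + 1, ¬ (silAmalgam P A π a V hV E).HasCycleOfLength n := by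
  have hinj : ∀ s, ∀ q ∈ P.rel s, Function.Injective (π ∘ q) := fun s q hq =>
    hA s _ (hπ s q hq)
  rintro n hn (⟨rfl, s, t, ⟨e, q, hq, rfl⟩, hninj⟩ | ⟨hn2, x, r, hx, hxi, hri, hinc⟩)
  · exact hninj ((silCopy_inj π a E hE e).comp (hinj s q hq).of_comp)
  -- edges
  have hrel : ∀ i, ∃ e : E, i < n → ∃ q ∈ P.rel (r i).1, (r i).2 = silCopy π a E e ∘ q := by
    intro i
    by_cases h : i < n
    · obtain ⟨e, he⟩ := (hinc i h).1
      exact ⟨e, fun _ => he⟩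
    · obtain ⟨e, he⟩ := (hinc 0 (by omega)).1
      exact ⟨e, fun h' => absurd h' h⟩
  choose e0 he0 using hrel
  obtain ⟨e, he⟩ : ∃ e : ℕ → E, e = fun i => e0 (i % n) := ⟨_, rfl⟩
  have hdat : ∀ i < n, ∃ q ∈ P.rel (r i).1, (r i).2 = silCopy π a E (e i) ∘ q := by
    intro i hi
    have h4 : e i = e0 i := by rw [he]; exact congrArg e0 (Nat.mod_eq_of_lt hi)
    rw [h4]
    exact he0 i hi
  have hen : e n = e 0 := by simp [he]
  have hxl : ∀ i < n, ∃ p, silCopy π a E (e i) p = x i := by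
    intro i hi
    obtain ⟨q, hq, hrq⟩ := hdat i hi
    obtain ⟨-, ⟨j, hj⟩, -⟩ := hinc i hi
    exact ⟨q j, by rw [← hj, hrq]; rfl⟩
  have hxr : ∀ i < n, ∃ p, silCopy π a E (e i) p = x (i + 1) := by
    intro i hi
    obtain ⟨q, hq, hrq⟩ := hdat i hi
    obtain ⟨-, -, ⟨j, hj⟩⟩ := hinc i hi
    exact ⟨q j, by rw [← hj, hrq]; rfl⟩
  have hxl' : ∀ i ≤ n, ∃ p, silCopy π a E (e i) p = x i := by
    intro i hi
    rcases hi.lt_or_eq with h | h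
    · exact hxl i h
    · subst h
      rw [hen, hx]
      exact hxl 0 (by omega)
  have hbreak : ∀ i < n, e i ≠ e (i + 1) → silProj π a E (x (i + 1)) = a ∧
      ∃ v, x (i + 1) = Sum.inl v ∧ (∃ j, (e i).1 j = v) ∧ (∃ j, (e (i + 1)).1 j = v) := by
    intro i hi hne
    obtain ⟨p, hp⟩ := hxr i hi
    obtain ⟨p', hp'⟩ := hxl' (i + 1) (by omega)
    obtain ⟨h1, h2⟩ := silCopy_ne π a E _ _ hne p p' (hp.trans hp'.symm)
    rw [hp] at h2
    refine ⟨?_, h2⟩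
    rw [← hp, silProj_copy, h1]
  have hx1 : ∀ i < n, ∀ j < n, x (i + 1) = x (j + 1) → i = j := by
    intro i hi j hj h
    by_cases h1 : i + 1 < n <;> by_cases h2 : j + 1 < n
    · have := hxi _ h1 _ h2 h
      omega
    · have h3 : j + 1 = n := by omega
      rw [h3, hx] at h
      have := hxi _ h1 0 (by omega) h
      omega
    · have h3 : i + 1 = n := by omega
      rw [h3, hx] at h
      have := hxi 0 (by omega) _ h2 h
      omega
    · omega
  have hD := sil_closed (W := V ⊕ (E × {p // π p ≠ a})) (E := E)
    (fun w e => ∃ v, w = Sum.inl v ∧ ∃ j, e.1 j = v) (g + 1)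
    (by
      intro m hm2 hmg z u hz hzi hui hzu
      have hz' : ∀ i, ∃ v, i ≤ m → z i = Sum.inl v := by
        intro i
        by_cases h : i < m
        · obtain ⟨⟨v, hv, -⟩, -⟩ := hzu i h
          exact ⟨v, fun _ => hv⟩
        · obtain ⟨⟨v, hv, -⟩, -⟩ := hzu 0 (by omega)
          refine ⟨v, fun h' => ?_⟩
          have : i = m := by omega
          rw [this, hz, hv]
      choose w hw using hz'
      refine hcyc m hm2 (by omega) w u ?_ ?_ hui ?_
      · have h1 := hw m le_rfl
        have h2 := hw 0 (by omega)
        rw [hz, h2] at h1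
        exact (Sum.inl.inj h1).symm
      · intro i hi j hj hij
        apply hzi i hi j hj
        rw [hw i hi.le, hw j hj.le, hij]
      · intro i hi
        obtain ⟨⟨v, hv, hv'⟩, ⟨v2, hv2, hv2'⟩⟩ := hzu i hi
        rw [hw i hi.le] at hv
        rw [hw (i + 1) hi] at hv2
        rw [Sum.inl.inj hv, Sum.inl.inj hv2]
        exact ⟨hv', hv2'⟩)
    n hn e (fun i => x (i + 1)) hen hx1
    (by
      intro i hi
      by_cases h : e i = e (i + 1)
      · exact Or.inl h
      · obtain ⟨-, v, hv, h1, h2⟩ := hbreak i hi h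
        exact Or.inr ⟨⟨v, hv, h1⟩, ⟨v, hv, h2⟩⟩)
  rcases hD with hconst | heinj
  · -- everything lies in one copy
    have hxl2 : ∀ i, ∃ p, i ≤ n → silCopy π a E (e 0) p = x i := by
      intro i
      by_cases h : i ≤ n
      · obtain ⟨p, hp⟩ := hxl' i h
        rw [hconst i h] at hp
        exact ⟨p, fun _ => hp⟩
      · obtain ⟨p, hp⟩ := hxl' 0 (by omega)
        exact ⟨p, fun h' => absurd h' h⟩
    choose z hz using hxl2
    have hq2 : ∀ i, ∃ u : Σ s : σ, Fin (ar s) → P.carrier, i < n →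
        u.2 ∈ P.rel u.1 ∧ r i = ⟨u.1, silCopy π a E (e 0) ∘ u.2⟩ := by
      intro i
      by_cases h : i < n
      · obtain ⟨q, hq, hrq⟩ := hdat i h
        rw [hconst i h.le] at hrq
        refine ⟨⟨(r i).1, q⟩, fun _ => ⟨hq, ?_⟩⟩
        exact Sigma.ext rfl (heq_of_eq hrq)
      · obtain ⟨q, hq, hrq⟩ := hdat 0 (by omega)
        exact ⟨⟨(r 0).1, q⟩, fun h' => absurd h' h⟩
    choose u hu using hq2
    have hci := silCopy_inj π a E hE (e 0)
    refine hP n hn (Or.inr ⟨hn2, z, u, ?_, ?_, ?_, ?_⟩)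
    · apply hci
      rw [hz n le_rfl, hz 0 (by omega), hx]
    · intro i hi j hj hij
      apply hxi i hi j hj
      rw [← hz i hi.le, ← hz j hj.le, hij]
    · intro i hi j hj hij
      apply hri i hi j hj
      rw [(hu i hi).2, (hu j hj).2, hij]
    · intro i hi
      obtain ⟨-, h1, h2⟩ := hinc i hi
      rw [(hu i hi).2] at h1 h2
      obtain ⟨j, hj⟩ := h1
      obtain ⟨j', hj'⟩ := h2
      rw [← hz i hi.le] at hj
      rw [← hz (i + 1) hi] at hj'
      exact ⟨(hu i hi).1, ⟨j, hci hj⟩, ⟨j', hci hj'⟩⟩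
  · have h01 : e 0 ≠ e 1 := fun h => by
      have := heinj 0 (by omega) 1 (by omega) h
      omega
    have h12 : e 1 ≠ e 2 := fun h => by
      by_cases h2 : 2 < n
      · have := heinj 1 (by omega) 2 (by omega) h
        omega
      · have h3 : n = 2 := by omega
        subst h3
        rw [hen] at h
        exact h01 h.symm
    have p1 := (hbreak 0 (by omega) h01).1
    have p2 := (hbreak 1 (by omega) h12).1
    obtain ⟨q, hq, hrq⟩ := hdat 1 (by omega)
    obtain ⟨-, ⟨j, hj⟩, ⟨j', hj'⟩⟩ := hinc 1 (by omega)
    have hjj : j = j' := by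
      apply hinj _ q hq
      have a1 : silProj π a E (x 1) = π (q j) := by
        rw [← hj, hrq, Function.comp_apply, silProj_copy]
      have a2 : silProj π a E (x (1 + 1)) = π (q j') := by
        rw [← hj', hrq, Function.comp_apply, silProj_copy]
      simp only [Function.comp_apply, ← a1, ← a2]
      exact p1.trans p2.symm
    subst hjj
    have := hx1 0 (by omega) 1 (by omega) (hj.symm.trans hj')
    omega

/-- Disjoint union of single tuples and isolated points. -/
def silP0 [Finite σ] (A : RStruct σ ar) : RStruct σ ar where
  carrier := A.carrier ⊕ (Σ s : σ, (A.rel s) × Fin (ar s))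
  fin := by
    have := A.fin
    infer_instance
  rel s := {q | ∃ t : A.rel s, q = fun i => Sum.inr ⟨s, t, i⟩}

/-- Projection of `silP0`. -/
def silπ0 [Finite σ] (A : RStruct σ ar) : (silP0 A).carrier → A.carrier :=
  Sum.elim id (fun u => u.2.1.1 u.2.2)

theorem silP0_eq [Finite σ] (A : RStruct σ ar) (r0 r1 : Σ s : σ, Fin (ar s) → (silP0 A).carrier)
    (h0 : r0.2 ∈ (silP0 A).rel r0.1) (h1 : r1.2 ∈ (silP0 A).rel r1.1)
    (j0 : Fin (ar r0.1)) (j1 : Fin (ar r1.1)) (h : r0.2 j0 = r1.2 j1) : r0 = r1 := by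
  obtain ⟨s0, q0⟩ := r0
  obtain ⟨s1, q1⟩ := r1
  obtain ⟨t0, ht0⟩ := h0
  obtain ⟨t1, ht1⟩ := h1
  change q0 = _ at ht0
  change q1 = _ at ht1
  change q0 j0 = q1 j1 at h
  rw [ht0, ht1] at h
  rw [ht0, ht1]
  clear ht0 ht1
  have h2 : (⟨s0, t0, j0⟩ : Σ s : σ, (A.rel s) × Fin (ar s)) = ⟨s1, t1, j1⟩ := Sum.inr.inj h
  clear h
  change Fin (ar s0) at j0
  change Fin (ar s1) at j1
  obtain ⟨h3, h4⟩ := Sigma.mk.inj h2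
  clear h2
  subst h3
  have h5 := eq_of_heq h4
  rw [(Prod.mk.inj h5).1]

theorem silP0_cycle [Finite σ] (A : RStruct σ ar) (n : ℕ) : ¬ (silP0 A).HasCycleOfLength n := by
  rintro (⟨rfl, s, t, ⟨t, rfl⟩, hninj⟩ | ⟨hn2, x, r, hx, hxi, hri, hinc⟩)
  · apply hninj
    intro i j h
    have h2 := eq_of_heq (Sigma.mk.inj (Sum.inr.inj h)).2
    exact (Prod.mk.inj h2).2
  · obtain ⟨h0, -, ⟨j0, hj0⟩⟩ := hinc 0 (by omega)
    obtain ⟨h1, ⟨j1, hj1⟩, -⟩ := hinc 1 (by omega)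
    have hne : r 0 ≠ r 1 := fun h => by
      have := hri 0 (by omega) 1 (by omega) h
      omega
    apply hne
    exact silP0_eq A (r 0) (r 1) h0 h1 j0 j1 (hj0.trans hj1.symm)

theorem sil_iter [Finite σ] (g : ℕ) (hg : 1 ≤ g) (hS : SilStmt g) (k : ℕ) (A : RStruct σ ar)
    (hA : A.InjTuples) (S : Set A.carrier) (hSf : S.Finite) :
    ∃ (P : RStruct σ ar) (π : P.carrier → A.carrier), IsHom P A π ∧
      (∀ n ≤ g + 1, ¬ P.HasCycleOfLength n) ∧
      ∀ C : RStruct σ ar, Nat.card C.carrier ≤ k → ∀ f, IsHom P C f →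
        ∃ φ : (silP0 A).carrier → P.carrier, IsHom (silP0 A) P φ ∧ (∀ p, π (φ p) = silπ0 A p) ∧
          ∀ p q, silπ0 A p ∈ S → silπ0 A p = silπ0 A q → f (φ p) = f (φ q) := by
  induction S, hSf using Set.Finite.induction_on with
  | empty =>
    refine ⟨silP0 A, silπ0 A, ?_, fun n _ => silP0_cycle A n, ?_⟩
    · rintro s q ⟨t, rfl⟩
      exact t.2
    · intro C hC f hf
      refine ⟨id, fun s t ht => ht, fun p => rfl, fun p q hp => absurd hp (by simp)⟩
  | @insert a S _ _ ih =>
    obtain ⟨P, π, hπ, hcyc, hP⟩ := ih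
    have := P.fin
    obtain ⟨V, hV, E, hE, hcol, hEc⟩ := sil_hyper g hg hS {p // π p = a} k
    refine ⟨silAmalgam P A π a V hV E, silProj π a E, ?_,
      silAmalgam_cycle P A hA π hπ a V hV E hE g hEc hcyc, ?_⟩
    · rintro s t ⟨e, q, hq, rfl⟩
      have h1 : silProj π a E ∘ silCopy π a E e ∘ q = π ∘ q := by
        funext i
        exact silProj_copy π a E e (q i)
      exact h1 ▸ hπ s q hq
    · intro C hC f hf
      obtain ⟨e, he, hec⟩ := hcol C.carrier C.fin hC (fun v => f (Sum.inl v))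
      obtain ⟨φ, hφ, hφπ, hφc⟩ := hP C hC (fun p => f (silCopy π a E ⟨e, he⟩ p))
        (fun s q hq => hf s _ ⟨⟨e, he⟩, q, hq, rfl⟩)
      refine ⟨fun p => silCopy π a E ⟨e, he⟩ (φ p), ?_, ?_, ?_⟩
      · intro s q hq
        exact ⟨⟨e, he⟩, _, hφ s q hq, rfl⟩
      · intro p
        rw [silProj_copy, hφπ]
      · intro p q hp hpq
        rcases hp with hp | hp
        · have h1 : π (φ p) = a := by rw [hφπ, hp]
          have h2 : π (φ q) = a := by rw [hφπ, ← hpq, hp]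
          have := hec ⟨φ p, h1⟩ ⟨φ q, h2⟩
          simpa [silCopy, h1, h2] using this
        · exact hφc p q hp hpq

end amalgam

theorem sil_step (g : ℕ) (hg : 1 ≤ g) (hS : SilStmt g) : SilStmt (g + 1) := by
  intro σ hσ ar k A hA
  have := A.fin
  obtain ⟨P, π, hπ, hcyc, hP⟩ := sil_iter g hg hS k A hA Set.univ Set.finite_univ
  refine ⟨P, ⟨π, hπ⟩, ?_, hcyc⟩
  rintro C hC ⟨f, hf⟩
  obtain ⟨φ, hφ, hφπ, hφc⟩ := hP C hC f hf
  refine ⟨fun a => f (φ (Sum.inl a)), ?_⟩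
  intro s t ht
  have h1 := hf s _ (hφ s (fun i => Sum.inr ⟨s, ⟨t, ht⟩, i⟩) ⟨⟨t, ht⟩, rfl⟩)
  have h2 : (fun a => f (φ (Sum.inl a))) ∘ t =
      f ∘ φ ∘ (fun i => Sum.inr ⟨s, ⟨t, ht⟩, i⟩) := by
    funext i
    exact hφc _ _ trivial rfl
  rw [h2]
  exact h1

theorem sil_all (g : ℕ) : SilStmt (g + 1) := by
  induction g with
  | zero =>
    intro σ _ ar k A hA
    refine ⟨A, ⟨id, fun s t ht => ht⟩, fun C _ h => h, ?_⟩
    rintro n hn (⟨rfl, s, t, ht, hni⟩ | ⟨h2, -⟩)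
    · exact hni (hA s t ht)
    · omega
  | succ g ih => exact sil_step (g + 1) (by omega) ih

end RStruct

/-- Sparse Incomparability Lemma: for positive `k, ℓ` and every structure `A`
there is a structure `B` with `B → A`, with `A → C ↔ B → C` for every `C` of at most `k`
elements, and with girth at least `ℓ` (no cycle of length `< ℓ`). -/
theorem sparse_incomparability {σ : Type} [Finite σ] {ar : σ → ℕ}
    (k ℓ : ℕ) (hk : 0 < k) (hℓ : 0 < ℓ) (A : RStruct σ ar) :
    ∃ B : RStruct σ ar,
      Hom B A ∧
      (∀ C : RStruct σ ar, Nat.card C.carrier ≤ k → (Hom A C ↔ Hom B C)) ∧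
      (∀ n < ℓ, ¬ B.HasCycleOfLength n) := by
  haveI := A.fin
  obtain ⟨R, hR⟩ : ∃ R, ∀ s, ar s ≤ R := by
    obtain ⟨R, hR⟩ := (Set.finite_range ar).bddAbove
    exact ⟨R, fun s => hR ⟨s, rfl⟩⟩
  let A' : RStruct σ ar := ⟨A.carrier × Fin (k * R + 1), inferInstance,
    fun s => {t | Function.Injective t ∧ (Prod.fst ∘ t) ∈ A.rel s}⟩
  obtain ⟨B, ⟨p, hp⟩, hBC, hcyc⟩ := sil_all ℓ σ inferInstance ar k A' (fun s t ht => ht.1)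
  have hBA : IsHom B A (Prod.fst ∘ p) := fun s t ht => (hp s t ht).2
  refine ⟨B, ⟨_, hBA⟩, ?_, fun n hn => hcyc n (by omega)⟩
  intro C hC
  constructor
  · rintro ⟨f, hf⟩
    exact ⟨f ∘ (Prod.fst ∘ p), fun s t ht => hf s _ (hBA s t ht)⟩
  · intro h
    obtain ⟨f, hf⟩ := hBC C hC h
    haveI := C.fin
    have hpig := fun a : A.carrier => sil_pigeon k R hC (fun i => f (a, i))
    choose c φ hφ hφc using hpig
    refine ⟨c, fun s t ht => ?_⟩
    have h1 := hf s (fun i => (t i, φ (t i) (Fin.castLE (hR s) i))) ⟨?_, ht⟩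
    · have h2 : c ∘ t = f ∘ (fun i => (t i, φ (t i) (Fin.castLE (hR s) i))) := by
        funext i
        exact (hφc (t i) _).symm
      rw [h2]
      exact h1
    · intro i j hij
      obtain ⟨h3, h4⟩ := Prod.mk.inj hij
      rw [h3] at h4
      exact Fin.castLE_injective _ (hφ _ h4)
end

section
/- Let Δ' consist of unary relation symbols only and let F' be a finite set of structures in Rel^cov(Δ,Δ'). If no member of F' contains a cycle (i.e. every F' ∈ F' is a relational forest), then there exists a finite set D of structures in Rel(Δ) such that Φ(Forb(F')) = CSP(D); in particular the language Φ(Forb(F')) is a finite union of CSP languages. -/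
open RStruct

namespace ForestProof

variable {τ : Type} {ar : τ → ℕ}

/-- Tree formulas with one free variable. -/
inductive Fm (τ : Type) (ar : τ → ℕ) : Type
  | tt : Fm τ ar
  | ex (s : τ) (i : Fin (ar s)) (φ : Fin (ar s) → Fm τ ar) : Fm τ ar

/-- Satisfaction of a tree formula at an element. -/
def Sat (A : RStruct τ ar) : Fm τ ar → A.carrier → Prop
  | Fm.tt, _ => True
  | Fm.ex s i φ, a => ∃ t ∈ A.rel s, t i = a ∧ ∀ j, Sat A (φ j) (t j)

/-- Subformulas. -/
def sub : Fm τ ar → Set (Fm τ ar)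
  | Fm.tt => {Fm.tt}
  | Fm.ex s i φ => {Fm.ex s i φ} ∪ ⋃ j, sub (φ j)

lemma sub_finite (φ : Fm τ ar) : (sub φ).Finite := by
  induction φ with
  | tt => exact Set.finite_singleton _
  | ex s i φ ih =>
    exact (Set.finite_singleton _).union (Set.finite_iUnion ih)

lemma self_mem_sub (φ : Fm τ ar) : φ ∈ sub φ := by
  cases φ <;> simp [sub]

lemma sub_closed (ψ : Fm τ ar) (s : τ) (i : Fin (ar s)) (φ : Fin (ar s) → Fm τ ar)
    (h : Fm.ex s i φ ∈ sub ψ) (j : Fin (ar s)) : φ j ∈ sub ψ := by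
  induction ψ with
  | tt => simp [sub] at h
  | ex s' i' φ' ih =>
    rcases h with h | h
    · have h' : Fm.ex s i φ = Fm.ex s' i' φ' := h
      cases h'
      exact Or.inr (Set.mem_iUnion.2 ⟨j, self_mem_sub _⟩)
    · obtain ⟨k, hk⟩ := Set.mem_iUnion.1 h
      exact Or.inr (Set.mem_iUnion.2 ⟨k, ih k hk⟩)

/-- Tuples over `V`. -/
abbrev Tup (ar : τ → ℕ) (V : Type) := Σ s : τ, Fin (ar s) → V

variable {V : Type}

def Adj (E : Set (Tup ar V)) (x y : V) : Prop :=
  ∃ e ∈ E, (∃ j, e.2 j = x) ∧ (∃ j, e.2 j = y)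

def Conn (E : Set (Tup ar V)) : V → V → Prop := Relation.ReflTransGen (Adj E)

lemma Adj.symm {E : Set (Tup ar V)} {x y : V} (h : Adj E x y) : Adj E y x := by
  obtain ⟨e, he, h1, h2⟩ := h
  exact ⟨e, he, h2, h1⟩

lemma Conn.symm {E : Set (Tup ar V)} {x y : V} (h : Conn E x y) : Conn E y x := by
  induction h with
  | refl => exact Relation.ReflTransGen.refl
  | tail _ h2 ih => exact Relation.ReflTransGen.head h2.symm ih

lemma Conn.trans {E : Set (Tup ar V)} {x y z : V} (h : Conn E x y) (h' : Conn E y z) :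
    Conn E x z := Relation.ReflTransGen.trans h h'

lemma Conn.mono {E E' : Set (Tup ar V)} (hE : E ⊆ E') {x y : V} (h : Conn E x y) :
    Conn E' x y := by
  induction h with
  | refl => exact Relation.ReflTransGen.refl
  | tail _ h2 ih =>
    obtain ⟨e, he, h⟩ := h2
    exact Relation.ReflTransGen.tail ih ⟨e, hE he, h⟩

lemma conn_tuple {E : Set (Tup ar V)} {e : Tup ar V} (he : e ∈ E) (i j : Fin (ar e.1)) :
    Conn E (e.2 i) (e.2 j) :=
  Relation.ReflTransGen.single ⟨e, he, ⟨i, rfl⟩, ⟨j, rfl⟩⟩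

/-- A single step. -/
def Step (E : Set (Tup ar V)) (e : Tup ar V) (x y : V) : Prop :=
  e ∈ E ∧ (∃ j, e.2 j = x) ∧ (∃ j, e.2 j = y)

/-- A walk of length `m` from `u` to `v`. -/
def IsWalk (E : Set (Tup ar V)) (m : ℕ) (u v : V) (x : ℕ → V) (r : ℕ → Tup ar V) : Prop :=
  x 0 = u ∧ x m = v ∧ ∀ i < m, Step E (r i) (x i) (x (i + 1))

lemma Conn.walk {E : Set (Tup ar V)} {u v : V} (h : Conn E u v) (e0 : Tup ar V) :
    ∃ m x r, IsWalk E m u v x r := by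
  induction h with
  | refl => exact ⟨0, fun _ => u, fun _ => e0, rfl, rfl, by simp⟩
  | @tail b c _ h2 ih =>
    obtain ⟨m, x, r, h0, hm, hw⟩ := ih
    obtain ⟨e, he, h3, h4⟩ := h2
    refine ⟨m + 1, fun k => if k ≤ m then x k else c, fun k => if k < m then r k else e,
      by simp [h0], by simp, ?_⟩
    intro i hi
    by_cases him : i < m
    · have h5 : i ≤ m := him.le
      have h6 : i + 1 ≤ m := him
      simp only [him, h5, h6, if_true]
      exact hw i him
    · have h5 : i = m := by omega
      subst h5
      have h6 : ¬ (i + 1 ≤ i) := by omega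
      simp only [lt_irrefl, le_refl, if_true, if_false, h6]
      rw [hm]
      exact ⟨he, h3, h4⟩

/-- Cut out the part of a walk between `i` and `j`. -/
lemma IsWalk.cut {E : Set (Tup ar V)} {m : ℕ} {u v : V} {x : ℕ → V} {r : ℕ → Tup ar V}
    (h : IsWalk E m u v x r) {i j : ℕ} (hij : i < j) (hj : j ≤ m)
    (hx : x i = x j ∨ (j < m ∧ r i = r j)) :
    ∃ x' r', IsWalk E (m - (j - i)) u v x' r' := by
  obtain ⟨h0, hm, hw⟩ := h
  by_cases hxx : x i = x j
  · refine ⟨fun k => if k ≤ i then x k else x (k + (j - i)),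
      fun k => if k < i then r k else r (k + (j - i)), by simp [h0], ?_, ?_⟩
    · by_cases hc : m - (j - i) ≤ i
      · have : j = m := by omega
        have h2 : m - (j - i) = i := by omega
        simp only [h2, le_refl, if_true]
        rw [hxx, this, hm]
      · have h2 : m - (j - i) + (j - i) = m := by omega
        simp [hc, h2, hm]
    · intro k hk
      rcases lt_trichotomy k i with hki | hki | hki
      · have h1 : k ≤ i := by omega
        have h2 : k + 1 ≤ i := by omega
        simp only [hki, h1, h2, if_true]
        exact hw k (by omega)
      · subst hki
        have h1 : k + (j - k) = j := by omega
        have h2 : k + 1 + (j - k) = j + 1 := by omega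
        have h3 : ¬ (k + 1 ≤ k) := by omega
        simp only [lt_irrefl, le_refl, if_true, if_false, h1, h2, h3, hxx]
        exact hw j (by omega)
      · have h1 : ¬ k ≤ i := by omega
        have h2 : ¬ k + 1 ≤ i := by omega
        have h3 : ¬ k < i := by omega
        have h4 : k + 1 + (j - i) = k + (j - i) + 1 := by omega
        simp only [h1, h2, h3, if_false, h4]
        exact hw (k + (j - i)) (by omega)
  · obtain ⟨hjm, hr⟩ := hx.resolve_left hxx
    refine ⟨fun k => if k ≤ i then x k else x (k + (j - i)),
      fun k => if k < i then r k else r (k + (j - i)), by simp [h0], ?_, ?_⟩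
    · have hc : ¬ m - (j - i) ≤ i := by omega
      have h2 : m - (j - i) + (j - i) = m := by omega
      simp [hc, h2, hm]
    · intro k hk
      rcases lt_trichotomy k i with hki | hki | hki
      · have h1 : k ≤ i := by omega
        have h2 : k + 1 ≤ i := by omega
        simp only [hki, h1, h2, if_true]
        exact hw k (by omega)
      · subst hki
        have h1 : k + (j - k) = j := by omega
        have h2 : k + 1 + (j - k) = j + 1 := by omega
        have h3 : ¬ (k + 1 ≤ k) := by omega
        simp only [lt_irrefl, le_refl, if_true, if_false, h1, h2, h3]
        refine ⟨(hw j hjm).1, ?_, (hw j hjm).2.2⟩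
        rw [← hr]
        exact (hw k (by omega)).2.1
      · have h1 : ¬ k ≤ i := by omega
        have h2 : ¬ k + 1 ≤ i := by omega
        have h3 : ¬ k < i := by omega
        have h4 : k + 1 + (j - i) = k + (j - i) + 1 := by omega
        simp only [h1, h2, h3, if_false, h4]
        exact hw (k + (j - i)) (by omega)

/-- Acyclicity of a set of tuples. -/
def Acyc (E : Set (Tup ar V)) : Prop :=
  (∀ e ∈ E, Function.Injective e.2) ∧
  ∀ n, 2 ≤ n → ∀ (x : ℕ → V) (r : ℕ → Tup ar V), x n = x 0 →
    (∀ i < n, ∀ j < n, x i = x j → i = j) →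
    (∀ i < n, ∀ j < n, r i = r j → i = j) →
    ¬ (∀ i < n, Step E (r i) (x i) (x (i + 1)))

lemma Acyc.mono {E E' : Set (Tup ar V)} (hE : E' ⊆ E) (h : Acyc E) : Acyc E' :=
  ⟨fun e he => h.1 e (hE he), fun n hn x r h0 h1 h2 h3 =>
    h.2 n hn x r h0 h1 h2 fun i hi => ⟨hE (h3 i hi).1, (h3 i hi).2⟩⟩

/-- Deleting a tuple disconnects its coordinates. -/
lemma Acyc.sep {E : Set (Tup ar V)} (h : Acyc E) {e : Tup ar V} (he : e ∈ E)
    {i j : Fin (ar e.1)} (hc : Conn (E \ {e}) (e.2 i) (e.2 j)) : i = j := by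
  classical
  by_contra hij
  have hex : ∃ m, ∃ x r, IsWalk (E \ {e}) m (e.2 i) (e.2 j) x r := hc.walk e
  obtain ⟨x, r, hw⟩ := Nat.find_spec hex
  set m := Nat.find hex with hmdef
  have hmin : ∀ k < m, ¬ ∃ x r, IsWalk (E \ {e}) k (e.2 i) (e.2 j) x r :=
    fun k hk => Nat.find_min hex hk
  have hxlt : ∀ a b, a < b → b ≤ m → x a ≠ x b := fun a b hab hb hxx =>
    hmin _ (by omega) (hw.cut hab hb (Or.inl hxx))
  have hrlt : ∀ a b, a < b → b < m → r a ≠ r b := fun a b hab hb hxx =>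
    hmin _ (by omega) (hw.cut hab hb.le (Or.inr ⟨hb, hxx⟩))
  obtain ⟨h0, hm, hw⟩ := hw
  have hm0 : m ≠ 0 := by
    intro hz
    rw [hz] at hm
    exact hij (h.1 e he (h0.symm.trans hm))
  have hre : ∀ a, a < m → r a ≠ e := fun a ha => (hw a ha).1.2
  refine h.2 (m + 1) (by omega) (fun k => if k ≤ m then x k else x 0)
    (fun k => if k < m then r k else e) (by simp) ?_ ?_ ?_
  · intro a ha b hb hab
    have h1 : a ≤ m := by omega
    have h2 : b ≤ m := by omega
    simp only [h1, h2, if_true] at hab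
    rcases lt_trichotomy a b with h3 | h3 | h3
    · exact absurd hab (hxlt a b h3 h2)
    · exact h3
    · exact absurd hab.symm (hxlt b a h3 h1)
  · intro a ha b hb hab
    by_cases h1 : a < m <;> by_cases h2 : b < m
    · simp only [h1, h2, if_true] at hab
      rcases lt_trichotomy a b with h3 | h3 | h3
      · exact absurd hab (hrlt a b h3 h2)
      · exact h3
      · exact absurd hab.symm (hrlt b a h3 h1)
    · simp only [h1, h2, if_true, if_false] at hab
      exact absurd hab (hre a h1)
    · simp only [h1, h2, if_true, if_false] at hab
      exact absurd hab.symm (hre b h2)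
    · omega
  · intro a ha
    by_cases h1 : a < m
    · have h2 : a ≤ m := by omega
      have h3 : a + 1 ≤ m := by omega
      simp only [h1, h2, h3, if_true]
      exact ⟨(hw a h1).1.1, (hw a h1).2⟩
    · have h2 : a = m := by omega
      have h3 : ¬ (m + 1 ≤ m) := by omega
      subst h2
      simp only [lt_irrefl, le_refl, if_true, if_false, h3]
      exact ⟨he, ⟨j, hm.symm⟩, ⟨i, h0.symm⟩⟩

/-- Every component of a finite forest is described by a tree formula. -/
lemma exists_formula (n : ℕ) : ∀ (E : Set (Tup ar V)), E.Finite → E.ncard = n → Acyc E → ∀ u : V,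
    ∃ φ : Fm τ ar, ∀ (A : RStruct τ ar) (a : A.carrier), Sat A φ a ↔
      ∃ f : V → A.carrier, f u = a ∧
        ∀ e ∈ E, (∃ j, Conn E u (e.2 j)) → (f ∘ e.2) ∈ A.rel e.1 := by
  classical
  induction n with
  | zero =>
    intro E hfin hcard _ u
    have hE : E = ∅ := (Set.ncard_eq_zero hfin).1 hcard
    refine ⟨Fm.tt, fun A a => ⟨fun _ => ⟨fun _ => a, rfl, ?_⟩, fun _ => trivial⟩⟩
    simp [hE]
  | succ n ih =>
    intro E hfin hcard hac u
    by_cases hu : ∃ e ∈ E, ∃ i, e.2 i = u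
    · obtain ⟨e, he, i, hi⟩ := hu
      have hcard' : (E \ {e}).ncard = n := by
        rw [Set.ncard_sdiff_singleton_of_mem he, hcard]; rfl
      have hsub : E \ {e} ⊆ E := Set.sdiff_subset
      have ih' := ih (E \ {e}) (hfin.subset hsub) hcard' (hac.mono hsub)
      choose ψ hψ using fun j => ih' (e.2 j)
      refine ⟨Fm.ex e.1 i ψ, fun A a => ⟨?_, ?_⟩⟩
      · rintro ⟨t, ht, hta, hs⟩
        choose g hg1 hg2 using fun j => (hψ j A (t j)).1 (hs j)
        let f : V → A.carrier := fun v =>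
          if h : ∃ j, Conn (E \ {e}) (e.2 j) v then g h.choose v else a
        have hf : ∀ j v, Conn (E \ {e}) (e.2 j) v → f v = g j v := by
          intro j v hv
          have h : ∃ j, Conn (E \ {e}) (e.2 j) v := ⟨j, hv⟩
          have : h.choose = j := hac.sep he (h.choose_spec.trans hv.symm)
          simp only [f, dif_pos h, this]
        have hfe : ∀ j, f (e.2 j) = t j := fun j =>
          (hf j _ Relation.ReflTransGen.refl).trans (hg1 j)
        refine ⟨f, by rw [← hi, hfe, hta], ?_⟩
        rintro e' he' ⟨k, hk⟩
        by_cases hee : e' = e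
        · subst hee
          have : f ∘ e'.2 = t := funext hfe
          rw [this]; exact ht
        · have he'' : e' ∈ E \ {e} := ⟨he', hee⟩
          have key : ∀ v, Conn E u v → ∃ j, Conn (E \ {e}) (e.2 j) v := by
            intro v hv
            induction hv with
            | refl => exact ⟨i, by rw [hi]; exact Relation.ReflTransGen.refl⟩
            | @tail b c _ h2 ihv =>
              obtain ⟨j, hj⟩ := ihv
              obtain ⟨e1, he1, hb, hc⟩ := h2
              by_cases h1 : e1 = e
              · subst h1
                obtain ⟨l, hl⟩ := hc
                exact ⟨l, by rw [hl]; exact Relation.ReflTransGen.refl⟩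
              · exact ⟨j, Relation.ReflTransGen.tail hj ⟨e1, ⟨he1, h1⟩, hb, hc⟩⟩
          obtain ⟨j, hj⟩ := key _ hk
          have hfg : f ∘ e'.2 = g j ∘ e'.2 :=
            funext fun l => hf j _ (hj.trans (conn_tuple he'' k l))
          rw [hfg]
          exact hg2 j e' he'' ⟨k, hj⟩
      · rintro ⟨f, hfu, hf⟩
        refine ⟨f ∘ e.2, hf e he ⟨i, by rw [hi]; exact Relation.ReflTransGen.refl⟩,
          by simp [hi, hfu], fun j => (hψ j A _).2 ⟨f, rfl, ?_⟩⟩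
        rintro e' he' ⟨k, hk⟩
        refine hf e' (hsub he') ⟨k, ?_⟩
        rw [← hi]
        exact (conn_tuple he i j).trans (hk.mono hsub)
    · refine ⟨Fm.tt, fun A a => ⟨fun _ => ⟨fun _ => a, rfl, ?_⟩, fun _ => trivial⟩⟩
      rintro e he ⟨j, hj⟩
      exfalso
      rcases Relation.ReflTransGen.cases_head hj with h | ⟨c, ⟨e1, he1, h1, _⟩, _⟩
      · exact hu ⟨e, he, j, h.symm⟩
      · exact hu ⟨e1, he1, h1⟩

def tuples (F : RStruct τ ar) : Set (Tup ar F.carrier) := {e | e.2 ∈ F.rel e.1}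

lemma acyc_of_forest (F : RStruct τ ar) (h : IsForest F) : Acyc (tuples F) := by
  refine ⟨fun e he => ?_, fun n hn x r h0 h1 h2 h3 => ?_⟩
  · by_contra hc
    exact h ⟨1, Or.inl ⟨rfl, e.1, e.2, he, hc⟩⟩
  · exact h ⟨n, Or.inr ⟨hn, x, r, h0, h1, h2, h3⟩⟩

/-- Homomorphisms from a forest are described by finitely many tree formulas. -/
lemma forest_sentences [Finite τ] (F : RStruct τ ar) (h : IsForest F) :
    ∃ φ : F.carrier → Fm τ ar, ∀ A : RStruct τ ar,
      (∀ f, IsHom F A f → ∀ u, Sat A (φ u) (f u)) ∧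
      ((∀ u, ∃ a, Sat A (φ u) a) → (∀ s, (F.rel s).Nonempty → (A.rel s).Nonempty) → Hom F A) := by
  classical
  haveI := F.fin
  choose φ hφ using exists_formula _ (tuples F) (Set.toFinite _) rfl (acyc_of_forest F h)
  refine ⟨φ, fun A => ⟨fun f hf u => (hφ u A _).2 ⟨f, rfl, fun e he _ => hf e.1 e.2 he⟩, ?_⟩⟩
  intro hs hne
  choose a ha using hs
  choose g _ hg2 using fun u => (hφ u A (a u)).1 (ha u)
  let S : Setoid F.carrier := ⟨Conn (tuples F), fun _ => Relation.ReflTransGen.refl,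
    fun h => h.symm, fun h h' => h.trans h'⟩
  let rep : F.carrier → F.carrier := fun v => (Quotient.mk S v).out
  have hrep : ∀ v, Conn (tuples F) (rep v) v := fun v => Quotient.mk_out (s := S) v
  have hrep2 : ∀ v w, Conn (tuples F) v w → rep v = rep w := fun v w hvw => by
    have : Quotient.mk S v = Quotient.mk S w := Quotient.sound hvw
    simp only [rep, this]
  refine ⟨fun v => g (rep v) v, fun s t ht => ?_⟩
  by_cases hj : Nonempty (Fin (ar s))
  · obtain ⟨j⟩ := hj
    have he : (⟨s, t⟩ : Tup ar F.carrier) ∈ tuples F := ht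
    have := hg2 (rep (t j)) ⟨s, t⟩ he ⟨j, hrep _⟩
    convert this using 1
    funext k
    have hk := hrep2 _ _ (conn_tuple he k j)
    simp only [Function.comp] at hk ⊢
    rw [hk]
  · obtain ⟨t', ht'⟩ := hne s ⟨t, ht⟩
    convert ht' using 1
    funext k
    exact absurd ⟨k⟩ hj

/-- The dual structure: types over `Sg` avoiding `N`, with the relations in `Z` empty. -/
def dual (Sg : Set (Fm τ ar)) (hSg : Sg.Finite) (N : Set Sg) (Z : Set τ) : RStruct τ ar where
  carrier := {S : Set Sg // (∀ x : Sg, x.1 = Fm.tt → x ∈ S) ∧ ∀ x ∈ N, x ∉ S}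
  fin := by
    haveI := hSg.to_subtype
    infer_instance
  rel s := {t | s ∉ Z ∧ ∀ (x : Sg) (i : Fin (ar s)) (φ : Fin (ar s) → Fm τ ar),
    x.1 = Fm.ex s i φ → (∀ j, ∃ y : Sg, y.1 = φ j ∧ y ∈ (t j).1) → x ∈ (t i).1}

lemma dual_sound (Sg : Set (Fm τ ar)) (hSg : Sg.Finite) (N : Set Sg) (Z : Set τ)
    (hcl : ∀ s i φ, Fm.ex s i φ ∈ Sg → ∀ j, φ j ∈ Sg)
    (B : RStruct τ ar) (h : B.carrier → (dual Sg hSg N Z).carrier)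
    (hh : IsHom B (dual Sg hSg N Z) h) (φ : Fm τ ar) :
    ∀ (hφ : φ ∈ Sg) (b : B.carrier), Sat B φ b → (⟨φ, hφ⟩ : Sg) ∈ (h b).1 := by
  induction φ with
  | tt => exact fun hφ b _ => (h b).2.1 _ rfl
  | ex s i φ ih =>
    rintro hφ b ⟨t, ht, rfl, hs⟩
    exact (hh s t ht).2 ⟨_, hφ⟩ i φ rfl
      fun j => ⟨⟨φ j, hcl _ _ _ hφ j⟩, rfl, ih j _ _ (hs j)⟩

lemma dual_complete (Sg : Set (Fm τ ar)) (hSg : Sg.Finite) (A : RStruct τ ar) :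
    Hom A (dual Sg hSg {x | ∀ a, ¬ Sat A x.1 a} {s | ¬ (A.rel s).Nonempty}) := by
  refine ⟨fun a => ⟨{x | Sat A x.1 a}, ?_, fun x hx => hx a⟩, ?_⟩
  · intro x hx
    show Sat A x.1 a
    rw [hx]; trivial
  · intro s t ht
    refine ⟨fun hZ => hZ ⟨t, ht⟩, fun x i φ hx hy => ?_⟩
    show Sat A x.1 (t i)
    rw [hx]
    refine ⟨t, ht, rfl, fun j => ?_⟩
    obtain ⟨y, hy1, hy2⟩ := hy j
    rw [← hy1]; exact hy2

theorem duality [Finite τ] (F : Set (RStruct τ ar)) (hF : F.Finite)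
    (hfor : ∀ F0 ∈ F, IsForest F0) :
    ∃ D : Set (RStruct τ ar), D.Finite ∧ Forb F = CSP D := by
  classical
  have hch : ∀ F0 : F, _ := fun F0 => forest_sentences F0.1 (hfor F0.1 F0.2)
  choose φ hφ using hch
  let Sg : Set (Fm τ ar) := ⋃ F0 : F, ⋃ u, sub (φ F0 u)
  haveI := hF.to_subtype
  have hSg : Sg.Finite := Set.finite_iUnion fun F0 => by
    haveI := F0.1.fin
    exact Set.finite_iUnion fun u => sub_finite _
  have hmem : ∀ F0 u, φ F0 u ∈ Sg := fun F0 u =>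
    Set.mem_iUnion.2 ⟨F0, Set.mem_iUnion.2 ⟨u, self_mem_sub _⟩⟩
  have hcl : ∀ s i φ, Fm.ex s i φ ∈ Sg → ∀ j, φ j ∈ Sg := by
    intro s i ψ hψ j
    obtain ⟨F0, h1⟩ := Set.mem_iUnion.1 hψ
    obtain ⟨u, h2⟩ := Set.mem_iUnion.1 h1
    exact Set.mem_iUnion.2 ⟨F0, Set.mem_iUnion.2 ⟨u, sub_closed _ _ _ _ h2 j⟩⟩
  haveI := hSg.to_subtype
  refine ⟨(fun p : Set Sg × Set τ => dual Sg hSg p.1 p.2) ''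
    {p | ∀ F0 : F, (∃ u, (⟨φ F0 u, hmem F0 u⟩ : Sg) ∈ p.1) ∨
      ∃ s ∈ p.2, (F0.1.rel s).Nonempty}, (Set.toFinite _).image _, ?_⟩
  ext A
  constructor
  · intro hA
    refine ⟨_, ⟨⟨{x | ∀ a, ¬ Sat A x.1 a}, {s | ¬ (A.rel s).Nonempty}⟩, ?_, rfl⟩,
      dual_complete Sg hSg A⟩
    intro F0
    by_contra hc
    rw [not_or] at hc
    have hc2 : ∀ s, ¬ (A.rel s).Nonempty → ¬ (F0.1.rel s).Nonempty :=
      fun s h1 h2 => hc.2 ⟨s, h1, h2⟩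
    refine hA F0.1 F0.2 ((hφ F0 A).2 (fun u => ?_) fun s hs => ?_)
    · by_contra hu
      exact hc.1 ⟨u, fun a ha => hu ⟨a, ha⟩⟩
    · by_contra hs'
      exact hc2 s hs' hs
  · rintro ⟨_, ⟨⟨N, Z⟩, hp, rfl⟩, h, hh⟩ F0 hF0 ⟨g, hg⟩
    rcases hp ⟨F0, hF0⟩ with ⟨u, hu⟩ | ⟨s, hs, t, ht⟩
    · exact (h (g u)).2.2 _ hu
        (dual_sound Sg hSg N Z hcl A h hh _ _ _ ((hφ ⟨F0, hF0⟩ A).1 g hg u))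
    · exact (hh s _ (hg s t ht)).1 hs

/-- The substructure of covered elements. -/
def covered {σ σ' : Type} {ar : σ → ℕ} (B : RStruct (σ ⊕ σ') (Sum.elim ar fun _ => 1)) :
    RStruct (σ ⊕ σ') (Sum.elim ar fun _ => 1) where
  carrier := {d : B.carrier // ∃ s' : σ', (fun _ => d) ∈ B.rel (Sum.inr s')}
  fin := by
    haveI := B.fin
    infer_instance
  rel s := {t | Subtype.val ∘ t ∈ B.rel s}

lemma covers_covered {σ σ' : Type} {ar : σ → ℕ}
    (B : RStruct (σ ⊕ σ') (Sum.elim ar fun _ => 1)) : Covers 1 (covered B) := by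
  intro t
  obtain ⟨s', hs'⟩ := (t 0).2
  refine ⟨s', ?_⟩
  show Subtype.val ∘ t ∈ B.rel (Sum.inr s')
  have h2 : Subtype.val ∘ t = fun _ => (t 0).1 := by
    funext k
    have hk : k = 0 := Subsingleton.elim (α := Fin 1) k 0
    rw [hk]; rfl
  rw [h2]; exact hs'

end ForestProof

/-- for monadic `Δ'`, if every member of the finite set `F'` of covering lifted
structures is a relational forest, then the shadow `Φ(Forb F')` is a finite union of CSP
languages, i.e. equals `CSP D` for a finite set `D` of `Δ`-structures. -/
theorem forest_lifts_give_csp {σ σ' : Type} [Finite σ] [Finite σ'] {ar : σ → ℕ}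
    (F' : Set (RStruct (σ ⊕ σ') (Sum.elim ar fun _ => 1)))
    (hF'fin : F'.Finite) (hF'cov : ∀ F0 ∈ F', Covers 1 F0)
    (hforest : ∀ F0 ∈ F', IsForest F0) :
    ∃ D : Set (RStruct σ ar), D.Finite ∧
      {A : RStruct σ ar | ∃ A' : RStruct (σ ⊕ σ') (Sum.elim ar fun _ => 1),
        Covers 1 A' ∧ shadow A' = A ∧ ∀ F0 ∈ F', ¬ Hom F0 A'} = CSP D := by
  classical
  obtain ⟨D, hD, hDF⟩ := ForestProof.duality F' hF'fin hforest
  refine ⟨(fun B => shadow (ForestProof.covered B)) '' D, hD.image _, ?_⟩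
  ext A
  constructor
  · rintro ⟨A', hcov, rfl, hA'⟩
    have h1 : A' ∈ CSP D := hDF ▸ (show A' ∈ Forb F' from hA')
    obtain ⟨B, hB, f, hf⟩ := h1
    refine ⟨_, ⟨B, hB, rfl⟩, fun a => ⟨f a, ?_⟩, fun s t ht => hf (Sum.inl s) t ht⟩
    obtain ⟨s', hs'⟩ := hcov fun _ => a
    exact ⟨s', hf (Sum.inr s') _ hs'⟩
  · rintro ⟨_, ⟨B, hB, rfl⟩, f, hf⟩
    let A' : RStruct (σ ⊕ σ') (Sum.elim ar fun _ => 1) :=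
      ⟨A.carrier, A.fin, fun s => match s with
        | Sum.inl s => A.rel s
        | Sum.inr s' => {t | f ∘ t ∈ (ForestProof.covered B).rel (Sum.inr s')}⟩
    have h1 : A' ∈ CSP D := by
      refine ⟨B, hB, fun a => (f a).1, ?_⟩
      rintro (s | s') t ht
      · exact hf s t ht
      · exact ht
    have h2 : A' ∈ Forb F' := hDF ▸ h1
    exact ⟨A', fun t => ForestProof.covers_covered B (f ∘ t), rfl, h2⟩
end
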